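/- arXiv:1112.3397 — 2 statements merged into one kernel-verified Lean document; each statement's English description precedes it below -/
import Mathlib

section
/- (Parallel Wall Theorem, Brink–Howlett) Let (W,S) be a finitely generated Coxeter system with Cayley graph Λ(W,S). For each positive integer n there is a constant P(n) such that the following holds: for every wall Q of Λ and every vertex p of Λ whose distance from Q̄ is at least P(n), there exist n distinct pairwise parallel walls each of which separates Q̄ from p. -/
/-!
Common definitions: Cayley graph of a Coxeter system, walls, sides,
bracket numbers, edge paths, quasi-geodesics, tracking.
-/

namespace CoxTrack

variable {B : Type*} {W : Type*} [Group W] {M : CoxeterMatrix B}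

/-- The word metric on the Cayley graph `Λ(W,S)`: `d u v = ℓ(u⁻¹ v)`. -/
noncomputable def d (cs : CoxeterSystem M W) (u v : W) : ℕ := cs.length (u⁻¹ * v)

/-- `u` and `v` are adjacent vertices (endpoints of a common edge) of `Λ(W,S)`. -/
def Adj (cs : CoxeterSystem M W) (u v : W) : Prop := ∃ i : B, v = u * cs.simple i

/-- The edge with endpoints `u` and `v` belongs to the wall of the reflection `t`
(i.e. `t` fixes this edge setwise, interchanging its endpoints). -/
def EdgeInWall (cs : CoxeterSystem M W) (t u v : W) : Prop :=
  Adj cs u v ∧ t * u = v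

/-- `v` is a vertex of `Q̄`, the union of the edges of the wall of the reflection `t`. -/
def InWallBar (cs : CoxeterSystem M W) (t v : W) : Prop :=
  ∃ i : B, t * v = v * cs.simple i

/-- Vertices `u` and `v` lie on the same side of the wall of the reflection `t`. -/
def SameSide (cs : CoxeterSystem M W) (t u v : W) : Prop :=
  (cs.length (t * u) < cs.length u ↔ cs.length (t * v) < cs.length v)

/-- The wall of the reflection `t` separates the vertices `u` and `v`. -/
def SeparatesPts (cs : CoxeterSystem M W) (t u v : W) : Prop := ¬ SameSide cs t u v

/-- The walls of the reflections `t` and `t'` are parallel: they are distinct and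
all edges of each one lie on one side of the other. -/
def Parallel (cs : CoxeterSystem M W) (t t' : W) : Prop :=
  t ≠ t' ∧ (∀ u v, InWallBar cs t' u → InWallBar cs t' v → SameSide cs t u v)
         ∧ (∀ u v, InWallBar cs t u → InWallBar cs t v → SameSide cs t' u v)

/-- The walls of the reflections `t` and `t'` cross (they are distinct and not parallel). -/
def Crosses (cs : CoxeterSystem M W) (t t' : W) : Prop := t ≠ t' ∧ ¬ Parallel cs t t'

/-- The wall of the reflection `r` separates `Q̄` (for the wall of the reflection `t`)
from the vertex `p`. -/
def SepWallFromPt (cs : CoxeterSystem M W) (r t p : W) : Prop :=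
  ∀ v, InWallBar cs t v → SeparatesPts cs r v p

/-- The distance from the vertex `p` to `Q̄` (the wall of the reflection `t`),
measured to the nearest vertex of `Q̄`. -/
noncomputable def wallDist (cs : CoxeterSystem M W) (t p : W) : ℕ :=
  sInf {n : ℕ | ∃ v, InWallBar cs t v ∧ d cs p v = n}

/-- `v 0, v 1, …, v n` are the consecutive vertices of an edge path of length `n` in `Λ(W,S)`. -/
def IsPath (cs : CoxeterSystem M W) (v : ℕ → W) (n : ℕ) : Prop :=
  ∀ k, k < n → Adj cs (v k) (v (k+1))

/-- `v 0, …, v n` are the consecutive vertices of a geodesic edge path of length `n`. -/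
def IsGeodesic (cs : CoxeterSystem M W) (v : ℕ → W) (n : ℕ) : Prop :=
  IsPath cs v n ∧ d cs (v 0) (v n) = n

/-- `v 0, v 1, …` are the consecutive vertices of an edge path ray. -/
def IsRay (cs : CoxeterSystem M W) (v : ℕ → W) : Prop := ∀ k, Adj cs (v k) (v (k+1))

/-- A geodesic edge path ray. -/
def IsGeodesicRay (cs : CoxeterSystem M W) (v : ℕ → W) : Prop :=
  IsRay cs v ∧ ∀ j k, j ≤ k → d cs (v j) (v k) = k - j

/-- `…, v (-1), v 0, v 1, …` are the consecutive vertices of an edge path line. -/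
def IsLine (cs : CoxeterSystem M W) (v : ℤ → W) : Prop := ∀ k : ℤ, Adj cs (v k) (v (k+1))

/-- A geodesic edge path line. -/
def IsGeodesicLine (cs : CoxeterSystem M W) (v : ℤ → W) : Prop :=
  IsLine cs v ∧ ∀ j k : ℤ, j ≤ k → (d cs (v j) (v k) : ℤ) = k - j

/-- The set of (reflections of) walls bracketing the vertex `v k` of the edge path
`v 0, …, v n`: walls containing an edge of the path before `v k` and an edge after `v k`. -/
def Brackets (cs : CoxeterSystem M W) (v : ℕ → W) (n k : ℕ) : Set W :=
  {t | ∃ j m, j < k ∧ k ≤ m ∧ m < n ∧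
      EdgeInWall cs t (v j) (v (j+1)) ∧ EdgeInWall cs t (v m) (v (m+1))}

/-- The set of walls bracketing the vertex `v k` of the edge path ray `v`. -/
def BracketsRay (cs : CoxeterSystem M W) (v : ℕ → W) (k : ℕ) : Set W :=
  {t | ∃ j m, j < k ∧ k ≤ m ∧
      EdgeInWall cs t (v j) (v (j+1)) ∧ EdgeInWall cs t (v m) (v (m+1))}

/-- The set of walls bracketing the vertex `v k` of the edge path line `v`. -/
def BracketsLine (cs : CoxeterSystem M W) (v : ℤ → W) (k : ℤ) : Set W :=
  {t | ∃ j m : ℤ, j < k ∧ k ≤ m ∧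
      EdgeInWall cs t (v j) (v (j+1)) ∧ EdgeInWall cs t (v m) (v (m+1))}

/-- The edge path `v 0, …, v n` is a `(lam, eps)`-quasi-geodesic. -/
def IsQG (cs : CoxeterSystem M W) (lam eps : ℝ) (v : ℕ → W) (n : ℕ) : Prop :=
  IsPath cs v n ∧ ∀ j k, j ≤ n → k ≤ n →
    |(j : ℝ) - (k : ℝ)| ≤ lam * (d cs (v j) (v k) : ℝ) + eps

/-- The edge path ray `v` is a `(lam, eps)`-quasi-geodesic. -/
def IsQGRay (cs : CoxeterSystem M W) (lam eps : ℝ) (v : ℕ → W) : Prop :=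
  IsRay cs v ∧ ∀ j k : ℕ, |(j : ℝ) - (k : ℝ)| ≤ lam * (d cs (v j) (v k) : ℝ) + eps

/-- The edge path line `v` is a `(lam, eps)`-quasi-geodesic. -/
def IsQGLine (cs : CoxeterSystem M W) (lam eps : ℝ) (v : ℤ → W) : Prop :=
  IsLine cs v ∧ ∀ j k : ℤ, |(j : ℝ) - (k : ℝ)| ≤ lam * (d cs (v j) (v k) : ℝ) + eps

/-- `P` is a Parallel Wall function for `(W,S)`: for each positive integer `n`, every wall `Q`
and every vertex `p` at distance at least `P n` from `Q̄`, there are `n` distinct pairwise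
parallel walls separating `Q̄` from `p`. -/
def IsParallelWallFn (cs : CoxeterSystem M W) (P : ℕ → ℕ) : Prop :=
  ∀ n : ℕ, 0 < n → ∀ t p : W, cs.IsReflection t → P n ≤ wallDist cs t p →
    ∃ T : Finset W, T.card = n ∧ (∀ r ∈ T, cs.IsReflection r) ∧
      (∀ r ∈ T, ∀ r' ∈ T, r ≠ r' → Parallel cs r r') ∧
      (∀ r ∈ T, SepWallFromPt cs r t p)

/-- `w 0, …, w m` (with distinguished approximation vertices `w (c 0), …, w (c n)`)
is an `L`-approximation of the edge path `v 0, …, v n`: it is an edge path with the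
same endpoints, the segment from `w (c i)` to `w (c (i+1))` is geodesic, and the
approximation vertex `w (c i)` is within `L` of `v i`. -/
def IsApprox (cs : CoxeterSystem M W) (L : ℕ) (v : ℕ → W) (n : ℕ)
    (w : ℕ → W) (m : ℕ) (c : ℕ → ℕ) : Prop :=
  IsPath cs w m ∧ c 0 = 0 ∧ c n = m ∧ (∀ i, i < n → c i ≤ c (i+1)) ∧
  w 0 = v 0 ∧ w m = v n ∧
  (∀ i, i ≤ n → d cs (w (c i)) (v i) ≤ L) ∧
  (∀ i, i < n → d cs (w (c i)) (w (c (i+1))) = c (i+1) - c i)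

section Auxiliary

variable [Fintype B] [DecidableEq B]

/-- The canonical bilinear form of a Coxeter matrix, `B(eᵢ, eⱼ) = -cos (π / mᵢⱼ)`. -/
noncomputable def form (M : CoxeterMatrix B) : (B → ℝ) →ₗ[ℝ] (B → ℝ) →ₗ[ℝ] ℝ :=
  Matrix.toLinearMap₂' ℝ (Matrix.of fun i j => -Real.cos (Real.pi / M i j))

/-- The simple root `eᵢ`. -/
def simpleRoot (i : B) : B → ℝ := Pi.single i 1

theorem form_apply (M : CoxeterMatrix B) (u v : B → ℝ) :
    form M u v = ∑ i, ∑ j, u i * v j * -Real.cos (Real.pi / M i j) := by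
  simp [form, Matrix.toLinearMap₂'_apply, mul_assoc]

theorem form_simpleRoot (M : CoxeterMatrix B) (i j : B) :
    form M (simpleRoot i) (simpleRoot j) = -Real.cos (Real.pi / M i j) := by
  rw [form_apply, Finset.sum_eq_single i, Finset.sum_eq_single j]
  · simp [simpleRoot]
  · intro b _ hb
    simp [simpleRoot, hb]
  · simp
  · intro b _ hb
    simp [simpleRoot, hb]
  · simp

theorem form_simpleRoot_self (M : CoxeterMatrix B) (i : B) :
    form M (simpleRoot i) (simpleRoot i) = 1 := by
  simp [form_simpleRoot]

theorem form_comm (M : CoxeterMatrix B) (u v : B → ℝ) : form M u v = form M v u := by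
  rw [form_apply, form_apply, Finset.sum_comm]
  refine Finset.sum_congr rfl fun i _ => Finset.sum_congr rfl fun j _ => ?_
  rw [M.symmetric j i, mul_comm (u j)]

theorem form_simpleRoot_nonpos (M : CoxeterMatrix B) {i j : B} (h : i ≠ j) :
    form M (simpleRoot i) (simpleRoot j) ≤ 0 := by
  rw [form_simpleRoot, neg_nonpos]
  apply Real.cos_nonneg_of_mem_Icc
  have h1 : M i j ≠ 1 := M.off_diagonal i j h
  have hpi := Real.pi_pos
  rcases Nat.eq_zero_or_pos (M i j) with h0 | h0
  · simp [h0]; positivity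
  · have : (2 : ℝ) ≤ M i j := by exact_mod_cast (show 2 ≤ M i j by omega)
    constructor
    · have : 0 ≤ Real.pi / M i j := by positivity
      linarith
    · gcongr

theorem eq_sum_simpleRoot (v : B → ℝ) : v = ∑ i, v i • simpleRoot i := by
  conv_lhs => rw [pi_eq_sum_univ v]
  refine Finset.sum_congr rfl fun i _ => ?_
  congr 1
  ext j
  simp [simpleRoot, Pi.single_apply, eq_comm]

/-- The orthogonal reflection in a vector `a` of norm one. -/
noncomputable def refl (M : CoxeterMatrix B) (a : B → ℝ) : Module.End ℝ (B → ℝ) :=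
  Module.preReflection a ((2 : ℝ) • form M a)

theorem refl_apply (M : CoxeterMatrix B) (a v : B → ℝ) :
    refl M a v = v - (2 * form M a v) • a := by
  simp [refl, Module.preReflection_apply]

theorem refl_refl (M : CoxeterMatrix B) {a : B → ℝ} (ha : form M a a = 1) (v : B → ℝ) :
    refl M a (refl M a v) = v := by
  simp only [refl_apply, map_sub, map_smul, ha]
  module

theorem refl_self (M : CoxeterMatrix B) {a : B → ℝ} (ha : form M a a = 1) :
    refl M a a = -a := by
  rw [refl_apply, ha]
  module

theorem form_refl_refl (M : CoxeterMatrix B) {a : B → ℝ} (ha : form M a a = 1) (u v : B → ℝ) :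
    form M (refl M a u) (refl M a v) = form M u v := by
  simp only [refl_apply, map_sub, map_smul, LinearMap.sub_apply, LinearMap.smul_apply, ha,
    smul_eq_mul, form_comm M u a]
  ring

theorem refl_mul_refl_pow (M : CoxeterMatrix B) (i j : B) :
    (refl M (simpleRoot i) * refl M (simpleRoot j)) ^ M i j = 1 := by
  by_cases hij : i = j
  · subst hij
    refine LinearMap.ext fun v => ?_
    simp [refl_refl M (form_simpleRoot_self M i)]
  rcases Nat.eq_zero_or_pos (M i j) with h0 | h0
  · simp [h0]
  have h1 : M i j ≠ 1 := M.off_diagonal i j hij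
  have hm : (2 : ℝ) ≤ M i j := by exact_mod_cast (show 2 ≤ M i j by omega)
  set θ := Real.pi / M i j with hθ
  have hpi := Real.pi_pos
  have hθ0 : 0 < θ := by positivity
  have hθ1 : θ < Real.pi := by
    rw [hθ, div_lt_iff₀ (by linarith)]; nlinarith
  have hs : 0 < Real.sin θ := Real.sin_pos_of_pos_of_lt_pi hθ0 hθ1
  set e := simpleRoot i with he
  set f := simpleRoot j with hf
  have hee : form M e e = 1 := form_simpleRoot_self M i
  have hff : form M f f = 1 := form_simpleRoot_self M j
  have hef : form M e f = -Real.cos θ := form_simpleRoot M i j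
  have hfe : form M f e = -Real.cos θ := by rw [form_comm, hef]
  set g := refl M e * refl M f with hg
  have hrot : ∀ ψ : ℝ, g (Real.sin (ψ + θ) • e + Real.sin ψ • f) =
      Real.sin (ψ + 2 * θ + θ) • e + Real.sin (ψ + 2 * θ) • f := by
    intro ψ
    have e1 : Real.sin (ψ + 2 * θ) = 2 * Real.cos θ * Real.sin (ψ + θ) - Real.sin ψ := by
      have := Real.sin_add (ψ + θ) θ
      have h2 := Real.sin_sub (ψ + θ) θ
      rw [show ψ + 2 * θ = ψ + θ + θ by ring]
      rw [show ψ + θ - θ = ψ by ring] at h2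
      linarith
    have e2 : Real.sin (ψ + 2 * θ + θ) =
        2 * Real.cos θ * Real.sin (ψ + 2 * θ) - Real.sin (ψ + θ) := by
      have := Real.sin_add (ψ + 2 * θ) θ
      have h2 := Real.sin_sub (ψ + 2 * θ) θ
      rw [show ψ + 2 * θ - θ = ψ + θ by ring] at h2
      linarith
    rw [e2, e1]
    simp only [hg, Module.End.mul_apply, refl_apply, map_sub, map_smul, map_add, hee, hff, hef,
      hfe]
    module
  have hrotn : ∀ (n : ℕ) (ψ : ℝ), (g ^ n) (Real.sin (ψ + θ) • e + Real.sin ψ • f) =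
      Real.sin (ψ + n * (2 * θ) + θ) • e + Real.sin (ψ + n * (2 * θ)) • f := by
    intro n
    induction n with
    | zero => intro ψ; simp
    | succ n ih =>
      intro ψ
      rw [pow_succ, Module.End.mul_apply, hrot, ih]
      push_cast
      congr 3 <;> ring
  have hfix : ∀ ψ : ℝ, (g ^ M i j) (Real.sin (ψ + θ) • e + Real.sin ψ • f) =
      Real.sin (ψ + θ) • e + Real.sin ψ • f := by
    intro ψ
    rw [hrotn]
    have : (M i j : ℝ) * (2 * θ) = 2 * Real.pi := by
      rw [hθ]; field_simp
    rw [this, show ψ + 2 * Real.pi + θ = ψ + θ + 2 * Real.pi by ring, Real.sin_add_two_pi,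
      Real.sin_add_two_pi]
  have hfe' : (g ^ M i j) e = e := by
    have := hfix 0
    simp only [zero_add, Real.sin_zero, zero_smul, add_zero, map_smul] at this
    exact smul_right_injective _ hs.ne' this
  have hff' : (g ^ M i j) f = f := by
    have := hfix (-θ)
    simp only [neg_add_cancel, Real.sin_zero, zero_smul, zero_add, map_smul] at this
    exact smul_right_injective _ (by simp [hs.ne']) this
  have hperp : ∀ v, form M e v = 0 → form M f v = 0 → ∀ n : ℕ, (g ^ n) v = v := by
    intro v h1 h2 n
    induction n with
    | zero => simp
    | succ n ih => rw [pow_succ, Module.End.mul_apply, hg, Module.End.mul_apply, refl_apply M f, h2,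
        mul_zero, zero_smul, sub_zero, refl_apply M e, h1, mul_zero, zero_smul, sub_zero, ← hg, ih]
  refine LinearMap.ext fun v => ?_
  have hsc := Real.sin_sq_add_cos_sq θ
  set c := Real.cos θ
  set x := (form M e v + c * form M f v) / Real.sin θ ^ 2
  set y := (form M f v + c * form M e v) / Real.sin θ ^ 2
  have hx : x * Real.sin θ ^ 2 = form M e v + c * form M f v := by
    simp only [x]; field_simp
  have hy : y * Real.sin θ ^ 2 = form M f v + c * form M e v := by
    simp only [y]; field_simp
  have hs2 : Real.sin θ ^ 2 ≠ 0 := by positivity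
  have hv := hperp (v - x • e - y • f)
    (by
      simp only [map_sub, map_smul, hee, hef, smul_eq_mul]
      apply mul_right_cancel₀ hs2
      linear_combination (-1) * hx + c * hy + form M e v * hsc)
    (by
      simp only [map_sub, map_smul, hff, hfe, smul_eq_mul]
      apply mul_right_cancel₀ hs2
      linear_combination c * hx - hy + form M f v * hsc) (M i j)
  simp only [map_sub, map_smul, hfe', hff'] at hv
  rw [sub_left_inj, sub_left_inj] at hv
  simpa using hv

/-- The geometric representation of a Coxeter group. -/
noncomputable def rep (cs : CoxeterSystem M W) : W →* Module.End ℝ (B → ℝ) :=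
  cs.lift ⟨fun i => refl M (simpleRoot i), refl_mul_refl_pow M⟩

variable (cs : CoxeterSystem M W)

theorem rep_simple (i : B) : rep cs (cs.simple i) = refl M (simpleRoot i) :=
  cs.lift_apply_simple _ i

theorem rep_mul_apply (u w : W) (v : B → ℝ) : rep cs (u * w) v = rep cs u (rep cs w v) := by
  simp

theorem rep_inv_rep (w : W) (v : B → ℝ) : rep cs w⁻¹ (rep cs w v) = v := by
  rw [← rep_mul_apply]; simp

theorem rep_rep_inv (w : W) (v : B → ℝ) : rep cs w (rep cs w⁻¹ v) = v := by
  rw [← rep_mul_apply]; simp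

theorem form_rep_rep (w : W) (u v : B → ℝ) : form M (rep cs w u) (rep cs w v) = form M u v := by
  induction w using cs.simple_induction_left with
  | one => simp
  | mul_simple_left w i ih =>
    rw [rep_mul_apply, rep_mul_apply, rep_simple, form_refl_refl M (form_simpleRoot_self M i), ih]

/-- The root system: the orbit of the simple roots. -/
def IsRoot (γ : B → ℝ) : Prop := ∃ w i, γ = rep cs w (simpleRoot i)

variable {cs}

theorem isRoot_simpleRoot (i : B) : IsRoot cs (simpleRoot i) := ⟨1, i, by simp⟩

theorem IsRoot.map_rep {γ : B → ℝ} (h : IsRoot cs γ) (w : W) : IsRoot cs (rep cs w γ) := by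
  obtain ⟨u, i, rfl⟩ := h
  exact ⟨w * u, i, by rw [rep_mul_apply]⟩

theorem IsRoot.form_self {γ : B → ℝ} (h : IsRoot cs γ) : form M γ γ = 1 := by
  obtain ⟨u, i, rfl⟩ := h
  rw [form_rep_rep, form_simpleRoot_self]

theorem IsRoot.ne_zero {γ : B → ℝ} (h : IsRoot cs γ) : γ ≠ 0 := by
  rintro rfl
  simpa using h.form_self

theorem IsRoot.neg {γ : B → ℝ} (h : IsRoot cs γ) : IsRoot cs (-γ) := by
  obtain ⟨u, i, rfl⟩ := h
  refine ⟨u * cs.simple i, i, ?_⟩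
  rw [rep_mul_apply, rep_simple, refl_self M (form_simpleRoot_self M i), map_neg]

theorem rep_reflection (w : W) (i : B) :
    rep cs (w * cs.simple i * w⁻¹) = refl M (rep cs w (simpleRoot i)) := by
  refine LinearMap.ext fun v => ?_
  rw [rep_mul_apply, rep_mul_apply, rep_simple, refl_apply, refl_apply, map_sub, map_smul,
    rep_rep_inv, ← form_rep_rep cs w, rep_rep_inv]

theorem IsRoot.map_refl {γ δ : B → ℝ} (hγ : IsRoot cs γ) (hδ : IsRoot cs δ) :
    IsRoot cs (refl M γ δ) := by
  obtain ⟨u, i, rfl⟩ := hγ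
  rw [← rep_reflection]
  exact hδ.map_rep _

/-- The value at `c` of the `n`-th Chebyshev polynomial of the second kind. -/
noncomputable def chebU (c : ℝ) (n : ℤ) : ℝ := (Polynomial.Chebyshev.U ℝ n).eval c

theorem chebU_zero (c : ℝ) : chebU c 0 = 1 := by simp [chebU]

theorem chebU_neg_one (c : ℝ) : chebU c (-1) = 0 := by simp [chebU]

theorem chebU_add_one (c : ℝ) (n : ℤ) : chebU c (n + 1) = 2 * c * chebU c n - chebU c (n - 1) := by
  simp [chebU, Polynomial.Chebyshev.U_add_one]

theorem chebU_sub_two (c : ℝ) (n : ℤ) : chebU c (n - 2) = 2 * c * chebU c (n - 1) - chebU c n := by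
  simp [chebU, Polynomial.Chebyshev.U_sub_two]

theorem chebU_cos (θ : ℝ) (n : ℤ) :
    chebU (Real.cos θ) n * Real.sin θ = Real.sin ((n + 1) * θ) :=
  Polynomial.Chebyshev.U_real_cos θ n

theorem chebU_cos_pi_div_nonneg {m k : ℕ} (h : m = 0 ∨ k ≤ m) :
    0 ≤ chebU (Real.cos (Real.pi / m)) (k - 1) := by
  rcases Nat.eq_zero_or_pos m with rfl | hm
  · simp [chebU, Polynomial.Chebyshev.U_eval_one]
  have hk : k ≤ m := by omega
  rcases Nat.lt_or_ge 1 m with hm1 | hm1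
  · have hpi := Real.pi_pos
    have hm' : (1 : ℝ) < m := by exact_mod_cast hm1
    have hs : 0 < Real.sin (Real.pi / m) := by
      apply Real.sin_pos_of_pos_of_lt_pi (by positivity)
      rw [div_lt_iff₀ (by linarith)]
      nlinarith
    refine nonneg_of_mul_nonneg_left ?_ hs
    rw [chebU_cos]
    push_cast
    apply Real.sin_nonneg_of_nonneg_of_le_pi
    · simp only [sub_add_cancel]; positivity
    · rw [sub_add_cancel, ← mul_div_assoc, div_le_iff₀ (by linarith), mul_comm]
      gcongr
  · obtain rfl : m = 1 := by omega
    interval_cases k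
    · simp [chebU_neg_one]
    · simp [chebU_zero]

theorem rep_alternatingWord (i j : B) (k : ℕ) :
    rep cs (cs.wordProd (CoxeterSystem.alternatingWord i j k)) (simpleRoot i) =
      chebU (Real.cos (Real.pi / M i j)) k • (if Even k then simpleRoot i else simpleRoot j) +
      chebU (Real.cos (Real.pi / M i j)) (k - 1) •
        (if Even k then simpleRoot j else simpleRoot i) := by
  have hij := form_simpleRoot M i j
  have hji := form_simpleRoot M j i
  rw [M.symmetric] at hji
  induction k with
  | zero => simp [CoxeterSystem.alternatingWord, chebU_zero, chebU_neg_one]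
  | succ k ih =>
    rw [CoxeterSystem.alternatingWord_succ', cs.wordProd_cons, rep_mul_apply, ih]
    push_cast
    rw [add_sub_cancel_right, chebU_add_one, rep_simple]
    by_cases hk : Even k
    · simp only [hk, if_true, Nat.even_add_one, not_true, if_false, refl_apply, map_add, map_smul,
        hji, form_simpleRoot_self]
      module
    · simp only [hk, if_true, Nat.even_add_one, not_false_eq_true, if_false, refl_apply, map_add,
        map_smul, hij, form_simpleRoot_self]
      module

theorem simpleRoot_nonneg (i : B) : (0 : B → ℝ) ≤ simpleRoot i :=
  Pi.single_nonneg.2 zero_le_one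

theorem rep_simpleRoot_nonneg {w : W} {i : B} (h : cs.length w < cs.length (w * cs.simple i)) :
    0 ≤ rep cs w (simpleRoot i) := by
  induction hn : cs.length w using Nat.strong_induction_on generalizing w i with
  | _ n ih =>
  subst hn
  by_cases hw : w = 1
  · simpa [hw] using simpleRoot_nonneg i
  obtain ⟨j, hj⟩ := cs.exists_rightDescent_of_ne_one hw
  let C : ℕ → Prop := fun k => ∃ v, w = v * cs.wordProd (CoxeterSystem.alternatingWord i j k) ∧
    cs.length w = cs.length v + k
  have hC0 : C 0 := ⟨w, by simp [CoxeterSystem.alternatingWord], by simp⟩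
  have hC1 : C 1 := by
    refine ⟨w * cs.simple j, by simp [CoxeterSystem.alternatingWord], ?_⟩
    have := cs.isRightDescent_iff.1 hj
    omega
  have hex : ∃ k, ¬ C k := by
    refine ⟨cs.length w + 1, ?_⟩
    rintro ⟨v, -, hv⟩
    omega
  classical
  obtain ⟨K, hK⟩ : ∃ K, Nat.find hex = K + 2 := by
    have h0 : Nat.find hex ≠ 0 := fun h => Nat.find_spec hex (by rwa [h])
    have h1 : Nat.find hex ≠ 1 := fun h => Nat.find_spec hex (by rwa [h])
    exact ⟨Nat.find hex - 2, by omega⟩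
  have hnot : ¬ C (K + 2) := hK ▸ Nat.find_spec hex
  have hyes : ∀ k ≤ K + 1, C k := fun k hk => by
    by_contra hc
    have := Nat.find_min' hex hc
    omega
  have hm : M i j = 0 ∨ K + 2 ≤ M i j := by
    by_contra! hm
    obtain ⟨v, hv, hl⟩ := hyes (M i j) (by omega)
    have hv' : w * cs.simple i =
        v * cs.wordProd (CoxeterSystem.alternatingWord i j (M i j - 1)) := by
      have h1 := cs.wordProd_braidWord_eq i j
      rw [CoxeterSystem.braidWord, CoxeterSystem.braidWord, M.symmetric j i] at h1
      obtain ⟨m, hm'⟩ := Nat.exists_eq_succ_of_ne_zero hm.1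
      rw [hv, h1, hm', Nat.succ_eq_add_one, CoxeterSystem.alternatingWord_succ, cs.wordProd_concat]
      simp [mul_assoc]
    have h2 := cs.length_mul_le v (cs.wordProd (CoxeterSystem.alternatingWord i j (M i j - 1)))
    have h3 := cs.length_wordProd_le (CoxeterSystem.alternatingWord i j (M i j - 1))
    rw [CoxeterSystem.length_alternatingWord] at h3
    rw [← hv'] at h2
    omega
  obtain ⟨v, hv, hl⟩ := hyes (K + 1) le_rfl
  have hnext : cs.length v < cs.length (v * cs.simple (if Even (K + 1) then j else i)) := by
    by_contra hc
    refine hnot ⟨v * cs.simple (if Even (K + 1) then j else i), ?_, ?_⟩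
    · rw [CoxeterSystem.alternatingWord_succ', cs.wordProd_cons, hv]
      simp [mul_assoc]
    · have := cs.length_mul_simple v (if Even (K + 1) then j else i)
      omega
  have hfirst : cs.length v < cs.length (v * cs.simple (if Even K then j else i)) := by
    by_contra hc
    rw [CoxeterSystem.alternatingWord_succ', cs.wordProd_cons, ← mul_assoc] at hv
    have h2 := cs.length_mul_le (v * cs.simple (if Even K then j else i))
      (cs.wordProd (CoxeterSystem.alternatingWord i j K))
    have h3 := cs.length_wordProd_le (CoxeterSystem.alternatingWord i j K)
    rw [CoxeterSystem.length_alternatingWord] at h3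
    rw [← hv] at h2
    have := cs.length_mul_simple v (if Even K then j else i)
    omega
  have hboth : ∀ l : B, l = i ∨ l = j → 0 ≤ rep cs v (simpleRoot l) := by
    rintro l hl'
    refine ih _ (by omega) (i := l) ?_ rfl
    by_cases hK' : Even K
    · rw [if_pos hK'] at hfirst
      rw [if_neg (by simpa [Nat.even_add_one] using hK')] at hnext
      rcases hl' with rfl | rfl <;> assumption
    · rw [if_neg hK'] at hfirst
      rw [if_pos (by simpa [Nat.even_add_one] using hK')] at hnext
      rcases hl' with rfl | rfl <;> assumption
  have h1 : 0 ≤ chebU (Real.cos (Real.pi / M i j)) (K + 1 : ℕ) := by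
    have := chebU_cos_pi_div_nonneg (m := M i j) (k := K + 2) hm
    push_cast at this ⊢
    rwa [show (K : ℤ) + 2 - 1 = K + 1 by ring] at this
  have h2 : 0 ≤ chebU (Real.cos (Real.pi / M i j)) ((K + 1 : ℕ) - 1) :=
    chebU_cos_pi_div_nonneg (m := M i j) (k := K + 1) (by omega)
  rw [hv, rep_mul_apply, rep_alternatingWord, map_add, map_smul, map_smul]
  refine add_nonneg (smul_nonneg h1 ?_) (smul_nonneg h2 ?_)
  · split_ifs <;> exact hboth _ (by simp)
  · split_ifs <;> exact hboth _ (by simp)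

theorem rep_mul_simple (w : W) (i : B) :
    rep cs (w * cs.simple i) (simpleRoot i) = -rep cs w (simpleRoot i) := by
  rw [rep_mul_apply, rep_simple, refl_self M (form_simpleRoot_self M i), map_neg]

theorem rep_simpleRoot_nonpos {w : W} {i : B} (h : cs.length (w * cs.simple i) < cs.length w) :
    rep cs w (simpleRoot i) ≤ 0 := by
  have := rep_simpleRoot_nonneg (cs := cs) (w := w * cs.simple i) (i := i) (by simpa using h)
  rwa [rep_mul_simple, neg_nonneg] at this

theorem IsRoot.nonneg_or_nonpos {γ : B → ℝ} (h : IsRoot cs γ) : 0 ≤ γ ∨ γ ≤ 0 := by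
  obtain ⟨w, i, rfl⟩ := h
  rcases cs.length_mul_simple w i with h | h
  · exact Or.inl (rep_simpleRoot_nonneg (by omega))
  · exact Or.inr (rep_simpleRoot_nonpos (by omega))

theorem IsRoot.not_nonpos {γ : B → ℝ} (h : IsRoot cs γ) (h0 : 0 ≤ γ) : ¬ γ ≤ 0 :=
  fun h1 => h.ne_zero (le_antisymm h1 h0)

theorem IsRoot.not_nonneg_iff {γ : B → ℝ} (h : IsRoot cs γ) : ¬ 0 ≤ γ ↔ γ ≤ 0 :=
  ⟨h.nonneg_or_nonpos.resolve_left, fun h1 h0 => h.not_nonpos h0 h1⟩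

theorem IsRoot.not_nonpos_iff {γ : B → ℝ} (h : IsRoot cs γ) : ¬ γ ≤ 0 ↔ 0 ≤ γ := by
  rw [← h.not_nonneg_iff, not_not]

theorem rep_injective : Function.Injective (rep cs) := by
  rw [injective_iff_map_eq_one]
  intro w hw
  by_contra hne
  obtain ⟨i, hi⟩ := cs.exists_rightDescent_of_ne_one hne
  have h := rep_simpleRoot_nonpos hi
  rw [hw] at h
  exact (isRoot_simpleRoot (cs := cs) i).not_nonpos (simpleRoot_nonneg i) h

theorem refl_neg (a : B → ℝ) : refl M (-a) = refl M a := by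
  refine LinearMap.ext fun v => ?_
  simp [refl_apply]

theorem IsRoot.eq_simpleRoot_of_forall_ne {γ : B → ℝ} (h : IsRoot cs γ) (h0 : 0 ≤ γ) {i : B}
    (hj : ∀ j, j ≠ i → γ j = 0) : γ = simpleRoot i := by
  have hγ : γ = γ i • simpleRoot i := by
    ext j
    by_cases hji : j = i
    · subst hji; simp [simpleRoot]
    · simp [simpleRoot, hj j hji, hji]
  have h1 := h.form_self
  rw [hγ, map_smul, map_smul, LinearMap.smul_apply, form_simpleRoot_self] at h1
  have h2 : γ i = 1 := by
    have h3 := h0 i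
    simp only [Pi.zero_apply, smul_eq_mul, mul_one] at h1 h3
    nlinarith
  rw [hγ, h2, one_smul]

/-- A positive root made nonpositive by a simple reflection is the corresponding simple root. -/
theorem IsRoot.eq_simpleRoot {γ : B → ℝ} (h : IsRoot cs γ) (h0 : 0 ≤ γ) {i : B}
    (hi : rep cs (cs.simple i) γ ≤ 0) : γ = simpleRoot i := by
  rw [rep_simple, refl_apply] at hi
  refine h.eq_simpleRoot_of_forall_ne h0 fun j hj => ?_
  have h1 := hi j
  have h2 := h0 j
  simp only [simpleRoot, Pi.sub_apply, Pi.smul_apply, Pi.single_eq_of_ne hj, smul_eq_mul,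
    mul_zero, sub_zero, Pi.zero_apply] at h1 h2
  exact le_antisymm h1 h2

theorem IsRoot.rep_simple_nonneg {γ : B → ℝ} (h : IsRoot cs γ) (h0 : 0 ≤ γ) {i : B}
    (hi : γ ≠ simpleRoot i) : 0 ≤ rep cs (cs.simple i) γ :=
  (h.map_rep _).not_nonpos_iff.1 fun h1 => hi (h.eq_simpleRoot h0 h1)

theorem rep_conj {t : W} {γ : B → ℝ} (h : rep cs t = refl M γ) (w : W) :
    rep cs (w * t * w⁻¹) = refl M (rep cs w γ) := by
  refine LinearMap.ext fun v => ?_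
  rw [rep_mul_apply, rep_mul_apply, h, refl_apply, refl_apply, map_sub, map_smul,
    rep_rep_inv, ← form_rep_rep cs w, rep_rep_inv]

theorem exists_isRoot {t : W} (h : cs.IsReflection t) :
    ∃ γ, IsRoot cs γ ∧ rep cs t = refl M γ := by
  obtain ⟨w, i, rfl⟩ := h
  exact ⟨_, ⟨w, i, rfl⟩, rep_reflection w i⟩

theorem IsRoot.exists_reflection {γ : B → ℝ} (h : IsRoot cs γ) :
    ∃ t, cs.IsReflection t ∧ rep cs t = refl M γ := by
  obtain ⟨w, i, rfl⟩ := h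
  exact ⟨_, ⟨w, i, rfl⟩, rep_reflection w i⟩

theorem length_reflection_mul_lt {t : W} {γ : B → ℝ} (hγ : IsRoot cs γ)
    (ht : rep cs t = refl M γ) (h0 : 0 ≤ γ) {u : W} (h : rep cs u⁻¹ γ ≤ 0) :
    cs.length (t * u) < cs.length u := by
  induction hn : cs.length u using Nat.strong_induction_on generalizing t γ u with
  | _ n ih =>
  subst hn
  by_cases hu : u = 1
  · subst hu
    exact absurd (by simpa using h) (hγ.not_nonpos h0)
  obtain ⟨j, hj⟩ := cs.exists_leftDescent_of_ne_one hu
  by_cases hγj : γ = simpleRoot j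
  · rw [hγj, ← rep_simple cs] at ht
    rwa [rep_injective ht]
  have hj' := cs.isLeftDescent_iff.1 hj
  have h1 := ih _ (by omega) (t := cs.simple j * t * (cs.simple j)⁻¹) (hγ.map_rep (cs.simple j))
    (rep_conj ht _) (hγ.rep_simple_nonneg h0 hγj) (u := cs.simple j * u)
    (by simpa [← rep_mul_apply] using h) rfl
  have h2 : cs.simple j * t * (cs.simple j)⁻¹ * (cs.simple j * u) = cs.simple j * (t * u) := by
    group
  rw [h2] at h1
  have := cs.length_simple_mul (t * u) j
  omega

/-- Sides of a wall correspond to signs of the root. -/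
theorem length_reflection_mul_lt_iff {t : W} {γ : B → ℝ} (hγ : IsRoot cs γ)
    (ht : rep cs t = refl M γ) (h0 : 0 ≤ γ) (u : W) :
    cs.length (t * u) < cs.length u ↔ rep cs u⁻¹ γ ≤ 0 := by
  refine ⟨fun h => ?_, length_reflection_mul_lt hγ ht h0⟩
  by_contra hc
  rw [(hγ.map_rep _).not_nonpos_iff] at hc
  have htt : t * t = 1 := rep_injective (cs := cs) (by
    refine LinearMap.ext fun v => ?_
    rw [rep_mul_apply, ht, refl_refl M hγ.form_self, map_one, Module.End.one_apply])
  have h1 := length_reflection_mul_lt hγ ht h0 (u := t * u) (by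
    rw [mul_inv_rev, rep_mul_apply, inv_eq_of_mul_eq_one_left htt, ht, refl_self M hγ.form_self,
      map_neg]
    exact neg_nonpos.2 hc)
  rw [← mul_assoc, htt, one_mul] at h1
  omega

theorem IsRoot.neg_nonpos_iff {γ : B → ℝ} (h : IsRoot cs γ) : -γ ≤ 0 ↔ ¬ γ ≤ 0 := by
  rw [neg_nonpos, h.not_nonpos_iff]

theorem sameSide_iff {t : W} {γ : B → ℝ} (hγ : IsRoot cs γ)
    (ht : rep cs t = refl M γ) (u v : W) :
    SameSide cs t u v ↔ (rep cs u⁻¹ γ ≤ 0 ↔ rep cs v⁻¹ γ ≤ 0) := by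
  rcases hγ.nonneg_or_nonpos with h0 | h0
  · rw [SameSide, length_reflection_mul_lt_iff hγ ht h0, length_reflection_mul_lt_iff hγ ht h0]
  · rw [← refl_neg] at ht
    rw [SameSide, length_reflection_mul_lt_iff hγ.neg ht (neg_nonneg.2 h0),
      length_reflection_mul_lt_iff hγ.neg ht (neg_nonneg.2 h0), map_neg, map_neg,
      (hγ.map_rep _).neg_nonpos_iff, (hγ.map_rep _).neg_nonpos_iff, not_iff_not]

theorem inWallBar_iff {t : W} {γ : B → ℝ} (hγ : IsRoot cs γ)
    (ht : rep cs t = refl M γ) (v : W) :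
    InWallBar cs t v ↔ ∃ i, rep cs v⁻¹ γ = simpleRoot i ∨ rep cs v⁻¹ γ = -simpleRoot i := by
  refine exists_congr fun i => ?_
  have h1 : rep cs (v⁻¹ * t * v) = refl M (rep cs v⁻¹ γ) := by
    simpa using rep_conj ht v⁻¹
  constructor
  · intro h
    have h2 : v⁻¹ * t * v = cs.simple i := by rw [mul_assoc, h]; simp
    rw [h2] at h1
    have h3 := (hγ.map_rep v⁻¹).form_self
    have h4 : rep cs (cs.simple i) (rep cs v⁻¹ γ) = -rep cs v⁻¹ γ := by
      rw [h1, refl_self M h3]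
    rcases (hγ.map_rep v⁻¹).nonneg_or_nonpos with h0 | h0
    · left
      exact (hγ.map_rep v⁻¹).eq_simpleRoot h0 (by rw [h4]; exact neg_nonpos.2 h0)
    · right
      rw [eq_comm, neg_eq_iff_eq_neg, eq_comm]
      exact (hγ.map_rep v⁻¹).neg.eq_simpleRoot (neg_nonneg.2 h0)
        (by rw [map_neg, h4, neg_neg]; exact h0)
  · intro h
    have h2 : v⁻¹ * t * v = cs.simple i := rep_injective (cs := cs) (by
      rw [h1, rep_simple]
      rcases h with h | h <;> simp [h, refl_neg])
    rw [← h2]; group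

theorem finite_setOf_nonneg_nonpos (u : W) :
    {γ : B → ℝ | IsRoot cs γ ∧ 0 ≤ γ ∧ rep cs u⁻¹ γ ≤ 0}.Finite := by
  induction u using cs.simple_induction_left with
  | one =>
    convert Set.finite_empty
    ext γ
    simp only [inv_one, map_one, Module.End.one_apply, Set.mem_ofPred_eq, Set.mem_empty_iff_false,
      iff_false]
    exact fun h => h.1.not_nonpos h.2.1 h.2.2
  | mul_simple_left u j ih =>
    refine ((ih.image (rep cs (cs.simple j))).insert (simpleRoot j)).subset ?_
    rintro γ ⟨h1, h2, h3⟩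
    by_cases h : γ = simpleRoot j
    · exact Or.inl h
    · refine Or.inr ⟨rep cs (cs.simple j) γ, ⟨h1.map_rep _, h1.rep_simple_nonneg h2 h, ?_⟩, ?_⟩
      · rwa [mul_inv_rev, cs.inv_simple, rep_mul_apply] at h3
      · rw [← rep_mul_apply, cs.simple_mul_simple_self, map_one, Module.End.one_apply]

/-- Only finitely many walls separate two given vertices. -/
theorem finite_setOf_separating (u v : W) :
    {γ : B → ℝ | IsRoot cs γ ∧ 0 ≤ rep cs u⁻¹ γ ∧ rep cs v⁻¹ γ ≤ 0}.Finite := by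
  refine ((finite_setOf_nonneg_nonpos (cs := cs) (u⁻¹ * v)).image (rep cs u)).subset ?_
  rintro γ ⟨h1, h2, h3⟩
  refine ⟨rep cs u⁻¹ γ, ⟨h1.map_rep _, h2, ?_⟩, rep_rep_inv cs u γ⟩
  rw [← rep_mul_apply]
  simpa using h3

/-- The orbit of two roots under the infinite dihedral group generated by their reflections. -/
theorem IsRoot.chebU_smul_sub {γ δ : B → ℝ} (hγ : IsRoot cs γ) (hδ : IsRoot cs δ) (n : ℤ) :
    IsRoot cs (chebU (form M γ δ) n • γ - chebU (form M γ δ) (n - 1) • δ) := by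
  set c := form M γ δ with hc
  suffices H : IsRoot cs (chebU c n • γ - chebU c (n - 1) • δ) ∧
      IsRoot cs (chebU c (n - 1) • γ - chebU c (n - 2) • δ) ∧
      form M (chebU c n • γ - chebU c (n - 1) • δ) (chebU c (n - 1) • γ - chebU c (n - 2) • δ) = c
    from H.1
  have hstep : ∀ a b : B → ℝ, IsRoot cs a → IsRoot cs b → form M a b = c →
      IsRoot cs ((2 * c) • a - b) ∧ form M ((2 * c) • a - b) a = c := by
    intro a b ha hb hab
    constructor
    · convert (ha.map_refl hb).neg using 1
      rw [refl_apply, hab, neg_sub]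
    · simp only [map_sub, map_smul, LinearMap.sub_apply, LinearMap.smul_apply, ha.form_self,
        form_comm M b a, hab, smul_eq_mul]
      ring
  induction n using Int.induction_on with
  | zero =>
    have h2 : chebU c (0 - 2) = -1 := by
      rw [chebU_sub_two, zero_sub, chebU_neg_one, chebU_zero]; ring
    rw [h2, zero_sub, chebU_neg_one, chebU_zero]
    simpa [← hc] using ⟨hγ, hδ⟩
  | succ n ih =>
    obtain ⟨h1, h2, h3⟩ := ih
    have := hstep _ _ h1 h2 h3
    have e1 := chebU_add_one c n
    have e2 := chebU_sub_two c n
    have e : chebU c (n + 1) • γ - chebU c (n + 1 - 1) • δ =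
        (2 * c) • (chebU c n • γ - chebU c (n - 1) • δ) -
          (chebU c (n - 1) • γ - chebU c (n - 2) • δ) := by
      rw [add_sub_cancel_right, e1, e2]
      module
    rw [e, add_sub_cancel_right, show (n : ℤ) + 1 - 2 = n - 1 by ring]
    exact ⟨this.1, h1, this.2⟩
  | pred n ih =>
    obtain ⟨h1, h2, h3⟩ := ih
    have := hstep _ _ h2 h1 (by rw [form_comm, h3])
    have e1 := chebU_sub_two c (-n)
    have e2 := chebU_sub_two c (-n - 1)
    have e : chebU c (-n - 2) • γ - chebU c (-n - 1 - 2) • δ =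
        (2 * c) • (chebU c (-n - 1) • γ - chebU c (-n - 2) • δ) -
          (chebU c (-n) • γ - chebU c (-n - 1) • δ) := by
      rw [show (-n - 1 - 1 : ℤ) = -n - 2 by ring] at e2
      rw [e2, e1]
      module
    rw [show (-n - 1 - 1 : ℤ) = -n - 2 by ring, e]
    exact ⟨h2, this.1, by rw [form_comm, this.2]⟩

/-- The sum of the coordinates of a vector. -/
noncomputable def height (v : B → ℝ) : ℝ := ∑ i, v i

theorem height_smul_sub (a b : ℝ) (u v : B → ℝ) :
    height (a • u - b • v) = a * height u - b * height v := by
  simp [height, Finset.sum_sub_distrib, Finset.mul_sum]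

theorem height_neg (v : B → ℝ) : height (-v) = -height v := by simp [height]

theorem height_nonneg {v : B → ℝ} (h : 0 ≤ v) : 0 ≤ height v :=
  Finset.sum_nonneg fun i _ => h i

theorem IsRoot.one_le_abs_height {γ : B → ℝ} (h : IsRoot cs γ) : 1 ≤ |height γ| := by
  wlog h0 : 0 ≤ γ generalizing γ
  · rw [← abs_neg, ← height_neg]
    exact this h.neg (neg_nonneg.2 (h.not_nonneg_iff.1 h0))
  have h1 : 1 ≤ height γ ^ 2 := by
    rw [← h.form_self, form_apply, sq, height, Finset.sum_mul_sum]
    refine Finset.sum_le_sum fun i _ => Finset.sum_le_sum fun j _ => ?_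
    have := Real.neg_one_le_cos (Real.pi / M i j)
    have := mul_nonneg (h0 i) (h0 j)
    nlinarith
  rw [abs_of_nonneg (height_nonneg h0)]
  nlinarith [height_nonneg h0]

theorem IsRoot.one_le_height {γ : B → ℝ} (h : IsRoot cs γ) (h0 : 0 ≤ γ) : 1 ≤ height γ := by
  simpa [abs_of_nonneg (height_nonneg h0)] using h.one_le_abs_height

/-- Two roots with `form M γ δ ≥ 1` cannot have all four sign patterns. -/
theorem IsRoot.not_cross {γ δ : B → ℝ} (hγ : IsRoot cs γ) (hδ : IsRoot cs δ)
    (hc : 1 ≤ form M γ δ) {u v : W} (hγu : 0 ≤ rep cs u⁻¹ γ) (hδu : rep cs u⁻¹ δ ≤ 0)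
    (hγv : rep cs v⁻¹ γ ≤ 0) (hδv : 0 ≤ rep cs v⁻¹ δ) : False := by
  set c := form M γ δ with hc'
  have hU : ∀ n : ℕ, 0 ≤ chebU c (n - 1) ∧ chebU c (n - 1) + 1 ≤ chebU c n := by
    intro n
    induction n with
    | zero => simp [chebU_neg_one, chebU_zero]
    | succ n ih =>
      push_cast
      rw [add_sub_cancel_right, chebU_add_one]
      constructor
      · linarith
      · nlinarith
  let x : ℕ → B → ℝ := fun n => chebU c n • γ - chebU c (n - 1) • δ
  have hxu : ∀ n, rep cs u⁻¹ (x n) =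
      chebU c n • rep cs u⁻¹ γ - chebU c (n - 1) • rep cs u⁻¹ δ := fun n => by
    simp [x]
  have hmono : StrictMono fun n => height (rep cs u⁻¹ (x n)) := by
    refine strictMono_nat_of_lt_succ fun n => ?_
    have h1 := (hU n).2
    have h2 := (hU (n + 1)).2
    have h3 := (hγ.map_rep u⁻¹).one_le_height hγu
    have h4 := height_nonneg (neg_nonneg.2 hδu)
    rw [height_neg] at h4
    rw [hxu, hxu, height_smul_sub, height_smul_sub]
    push_cast at h2 ⊢
    rw [add_sub_cancel_right] at h2 ⊢
    nlinarith
  have hinj : Function.Injective x := fun a b hab => hmono.injective (by simp only [hab])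
  refine Set.infinite_range_of_injective hinj ((finite_setOf_separating (cs := cs) u v).subset ?_)
  rintro _ ⟨n, rfl⟩
  have h1 := (hU n).1
  have h2 : 0 ≤ chebU c n := by linarith [(hU n).2]
  refine ⟨hγ.chebU_smul_sub hδ n, ?_, ?_⟩
  · rw [hxu, sub_eq_add_neg, ← smul_neg]
    exact add_nonneg (smul_nonneg h2 hγu) (smul_nonneg h1 (neg_nonneg.2 hδu))
  · simp only [x, map_sub, map_smul]
    rw [sub_nonpos]
    exact (smul_nonpos_of_nonneg_of_nonpos h2 hγv).trans (smul_nonneg h1 hδv)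

theorem exists_rat_mul_pi {θ p q : ℝ} (hθ : 0 < Real.sin θ)
    (h : ∀ n : ℤ, Real.sin θ ≤ |Real.sin ((n + 1) * θ) * p - Real.sin (n * θ) * q|) :
    ∃ r : ℚ, θ = r * Real.pi := by
  have hpi := Real.pi_pos
  have hirr : ¬ Irrational (θ / (2 * Real.pi)) := by
    intro hirr
    rw [← dense_addSubgroupClosure_pair_iff] at hirr
    let F : ℝ → ℝ := fun y => Real.sin (y + θ) * p - Real.sin y * q
    have hF : Continuous F := by fun_prop
    have hclosed : IsClosed {y | Real.sin θ ≤ |F y|} := isClosed_le continuous_const hF.abs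
    have huniv : ∀ y, Real.sin θ ≤ |F y| := by
      intro y
      have hsub : (AddSubgroup.closure {θ, 2 * Real.pi} : Set ℝ) ⊆ {y | Real.sin θ ≤ |F y|} := by
        intro y hy
        obtain ⟨m, n, rfl⟩ := AddSubgroup.mem_closure_pair.1 hy
        have h1 := h m
        simp only [Set.mem_ofPred_eq, F, zsmul_eq_mul]
        rw [show (m * θ + n * (2 * Real.pi) + θ : ℝ) = (m + 1) * θ + n * (2 * Real.pi) by ring,
          Real.sin_add_int_mul_two_pi, Real.sin_add_int_mul_two_pi]
        exact h1
      exact hclosed.closure_subset_iff.2 hsub (hirr y)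
    have hneg : F Real.pi = -F 0 := by
      simp only [F, zero_add, Real.sin_zero, Real.sin_pi]
      rw [add_comm, Real.sin_add_pi]
      ring
    have hzero : (0 : ℝ) ∈ Set.range F := by
      apply mem_range_of_exists_le_of_exists_ge hF
      · rcases le_total (F 0) 0 with h0 | h0
        · exact ⟨0, h0⟩
        · exact ⟨Real.pi, by rw [hneg]; linarith⟩
      · rcases le_total (F 0) 0 with h0 | h0
        · exact ⟨Real.pi, by rw [hneg]; linarith⟩
        · exact ⟨0, h0⟩
    obtain ⟨y, hy⟩ := hzero
    have := huniv y
    rw [hy, abs_zero] at this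
    linarith
  rw [Irrational, not_not] at hirr
  obtain ⟨r, hr⟩ := hirr
  refine ⟨2 * r, ?_⟩
  push_cast
  rw [hr]
  field_simp

theorem form_eq_cos_rat_mul_pi {γ δ : B → ℝ} (hγ : IsRoot cs γ) (hδ : IsRoot cs δ)
    (hc : |form M γ δ| < 1) : ∃ r : ℚ, form M γ δ = Real.cos (r * Real.pi) := by
  obtain ⟨h1, h2⟩ := abs_lt.1 hc
  have hcos := Real.cos_arccos h1.le h2.le
  set θ := Real.arccos (form M γ δ) with hθ
  have hs : 0 < Real.sin θ := by
    rw [hθ, Real.sin_arccos]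
    apply Real.sqrt_pos.2
    nlinarith
  obtain ⟨r, hr⟩ := exists_rat_mul_pi hs (p := height γ) (q := height δ) fun n => by
    have h3 := (hγ.chebU_smul_sub hδ n).one_le_abs_height
    rw [height_smul_sub, ← hcos] at h3
    have h4 := chebU_cos θ n
    have h5 := chebU_cos θ (n - 1)
    push_cast at h5
    rw [sub_add_cancel] at h5
    rw [← h4, ← h5, show ∀ a b s p q : ℝ, a * s * p - b * s * q = (a * p - b * q) * s by
      intros; ring, abs_mul, abs_of_pos hs]
    nlinarith
  exact ⟨r, by rw [← hr, hcos]⟩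

/-- The number field generated by the entries of the Gram matrix. -/
noncomputable def cosField (M : CoxeterMatrix B) : IntermediateField ℚ ℝ :=
  IntermediateField.adjoin ℚ (Set.range fun p : B × B => Real.cos (Real.pi / M p.1 p.2))

theorem cos_mem_cosField (M : CoxeterMatrix B) (i j : B) :
    Real.cos (Real.pi / M i j) ∈ cosField M :=
  IntermediateField.subset_adjoin _ _ ⟨(i, j), rfl⟩

theorem numberField_cosField (M : CoxeterMatrix B) : NumberField (cosField M) := by
  have : FiniteDimensional ℚ (cosField M) := by
    refine IntermediateField.finiteDimensional_adjoin ?_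
    rintro _ ⟨⟨i, j⟩, rfl⟩
    have h1 := (Real.isIntegral_two_mul_cos_rat_mul_pi (1 / M i j)).tower_top (A := ℚ)
    have h2 : IsIntegral ℚ (algebraMap ℚ ℝ (1 / 2)) := isIntegral_algebraMap
    have h3 := h2.mul h1
    have h4 : algebraMap ℚ ℝ (1 / 2) * (2 * Real.cos ((1 / M i j : ℚ) * Real.pi)) =
        Real.cos (Real.pi / M i j) := by
      rw [show (algebraMap ℚ ℝ) (1 / 2) = 1 / 2 by simp]
      push_cast
      ring_nf
    rwa [h4] at h3
  exact { to_charZero := inferInstance, to_finiteDimensional := this }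

theorem form_mem_cosField {u v : B → ℝ} (hu : ∀ i, u i ∈ cosField M) (hv : ∀ i, v i ∈ cosField M) :
    form M u v ∈ cosField M := by
  rw [form_apply]
  exact sum_mem fun i _ => sum_mem fun j _ =>
    mul_mem (mul_mem (hu i) (hv j)) (neg_mem (cos_mem_cosField M i j))

theorem simpleRoot_mem_cosField (i j : B) : simpleRoot i j ∈ cosField M := by
  by_cases h : j = i
  · subst h; simp [simpleRoot]
  · simp [simpleRoot, h]

theorem IsRoot.mem_cosField {γ : B → ℝ} (h : IsRoot cs γ) (i : B) : γ i ∈ cosField M := by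
  obtain ⟨w, j, rfl⟩ := h
  induction w using cs.simple_induction_left generalizing i with
  | one => simpa using simpleRoot_mem_cosField j i
  | mul_simple_left w k ih =>
    rw [rep_mul_apply, rep_simple, refl_apply]
    simp only [Pi.sub_apply, Pi.smul_apply, smul_eq_mul]
    exact sub_mem (ih i) (mul_mem (mul_mem (ofNat_mem _ 2)
      (form_mem_cosField (simpleRoot_mem_cosField k) ih)) (simpleRoot_mem_cosField k i))

theorem norm_map_le_two {K : IntermediateField ℚ ℝ} (φ : K →+* ℂ) {x : K} {r : ℚ}
    (hx : (x : ℝ) = 2 * Real.cos (r * Real.pi)) : ‖φ x‖ ≤ 2 := by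
  obtain ⟨y, hy, rfl⟩ : ∃ y : K, (y : ℝ) = Real.cos (r * Real.pi) ∧ x = 2 * y := by
    refine ⟨2⁻¹ * x, ?_, ?_⟩
    · change (2 : ℝ)⁻¹ * x = _
      rw [hx]; ring
    · rw [← mul_assoc, mul_inv_cancel₀ two_ne_zero, one_mul]
  set N : ℤ := 2 * r.den with hN
  have hN0 : (N : ℝ) ≠ 0 := by simp [hN]
  have h1 : (Polynomial.Chebyshev.T ℝ N).eval (y : ℝ) = 1 := by
    rw [hy, Polynomial.Chebyshev.T_real_cos, Real.cos_eq_one_iff]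
    refine ⟨r.num, ?_⟩
    have := Rat.mul_den_eq_num r
    have h' : (r : ℝ) * r.den = r.num := by exact_mod_cast this
    rw [hN]
    push_cast
    rw [← h']
    ring
  have h2 : (Polynomial.Chebyshev.T K N).eval y = 1 := by
    apply Subtype.val_injective
    exact (Polynomial.Chebyshev.algebraMap_eval_T y N).trans h1
  have h3 : (Polynomial.Chebyshev.T ℂ N).eval (φ y) = 1 := by
    rw [← Polynomial.Chebyshev.map_T φ, Polynomial.eval_map_apply, h2, map_one]
  obtain ⟨z, hz⟩ := Complex.cos_surjective (φ y)
  rw [← hz, Polynomial.Chebyshev.T_complex_cos, Complex.cos_eq_one_iff] at h3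
  obtain ⟨k, hk⟩ := h3
  have hz' : z = ((k * (2 * Real.pi) / N : ℝ) : ℂ) := by
    push_cast
    rw [hk]
    have : (N : ℂ) ≠ 0 := by exact_mod_cast hN0
    field_simp
  rw [map_mul, ← hz, hz', ← Complex.ofReal_cos, norm_mul, Complex.norm_real, map_ofNat,
    Real.norm_eq_abs]
  have := Real.abs_cos_le_one (k * (2 * Real.pi) / N)
  simp only [Complex.norm_ofNat]
  linarith

/-- The form takes only finitely many values in `(-1, 1)` on pairs of roots. -/
theorem finite_setOf_form (cs : CoxeterSystem M W) :
    {c : ℝ | |c| < 1 ∧ ∃ γ δ, IsRoot cs γ ∧ IsRoot cs δ ∧ form M γ δ = c}.Finite := by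
  have := numberField_cosField M
  refine ((NumberField.Embeddings.finite_of_norm_le (cosField M) ℂ 2).image
    fun x : cosField M => (x : ℝ) / 2).subset ?_
  rintro _ ⟨hc, γ, δ, hγ, hδ, rfl⟩
  obtain ⟨r, hr⟩ := form_eq_cos_rat_mul_pi hγ hδ hc
  have hmem : 2 * form M γ δ ∈ cosField M :=
    mul_mem (ofNat_mem _ 2) (form_mem_cosField hγ.mem_cosField hδ.mem_cosField)
  refine ⟨⟨_, hmem⟩, ⟨?_, fun φ => norm_map_le_two φ (r := r) (congrArg (2 * ·) hr)⟩, by simp⟩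
  refine (isIntegral_algebraMap_iff (algebraMap (cosField M) ℝ).injective).1 ?_
  change IsIntegral ℤ (2 * form M γ δ)
  rw [hr]
  exact Real.isIntegral_two_mul_cos_rat_mul_pi r

variable (cs) in
/-- Dominance: `δ` is nonpositive wherever `α` is. -/
def Dom (α δ : B → ℝ) : Prop := ∀ v, rep cs v⁻¹ α ≤ 0 → rep cs v⁻¹ δ ≤ 0

theorem Dom.trans {α δ ε : B → ℝ} (h1 : Dom cs α δ) (h2 : Dom cs δ ε) : Dom cs α ε :=
  fun v hv => h2 v (h1 v hv)

theorem Dom.map_rep {α δ : B → ℝ} (h : Dom cs α δ) (w : W) :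
    Dom cs (rep cs w α) (rep cs w δ) := by
  intro v hv
  have := h (w⁻¹ * v)
  rw [mul_inv_rev, inv_inv, rep_mul_apply, rep_mul_apply] at this
  exact this hv

theorem Dom.neg {α δ : B → ℝ} (hα : IsRoot cs α) (hδ : IsRoot cs δ) (h : Dom cs α δ) :
    Dom cs (-δ) (-α) := by
  intro v
  rw [map_neg, map_neg, (hα.map_rep _).neg_nonpos_iff, (hδ.map_rep _).neg_nonpos_iff]
  exact mt (h v)

theorem Dom.nonpos_of_inWallBar {α δ : B → ℝ} (hα : IsRoot cs α) (hδ : IsRoot cs δ)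
    (h : Dom cs α δ) (hne : δ ≠ α) {t : W} (ht : rep cs t = refl M α) {v : W}
    (hv : InWallBar cs t v) : rep cs v⁻¹ δ ≤ 0 := by
  obtain ⟨i, hi | hi⟩ := (inWallBar_iff hα ht v).1 hv
  · by_contra hc
    rw [(hδ.map_rep _).not_nonpos_iff] at hc
    have h1 := h (v * cs.simple i)
    rw [mul_inv_rev, cs.inv_simple, rep_mul_apply, rep_mul_apply, hi, rep_simple,
      refl_self M (form_simpleRoot_self M i), ← rep_simple cs] at h1
    have h2 := (hδ.map_rep v⁻¹).eq_simpleRoot hc (h1 (neg_nonpos.2 (simpleRoot_nonneg i)))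
    apply hne
    rw [← rep_rep_inv cs v δ, h2, ← hi, rep_rep_inv]
  · exact h v (by rw [hi]; exact neg_nonpos.2 (simpleRoot_nonneg i))

theorem Dom.nonneg_of_inWallBar {α δ : B → ℝ} (hα : IsRoot cs α) (hδ : IsRoot cs δ)
    (h : Dom cs α δ) (hne : δ ≠ α) {t : W} (ht : rep cs t = refl M δ) {v : W}
    (hv : InWallBar cs t v) : 0 ≤ rep cs v⁻¹ α := by
  have := (h.neg hα hδ).nonpos_of_inWallBar hδ.neg hα.neg (by simpa using hne.symm)
    (ht.trans (refl_neg δ).symm) hv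
  rwa [map_neg, neg_nonpos] at this

theorem Dom.parallel {α δ : B → ℝ} (hα : IsRoot cs α) (hδ : IsRoot cs δ)
    (h : Dom cs α δ) (hne : δ ≠ α) {t r : W} (ht : rep cs t = refl M α)
    (hr : rep cs r = refl M δ) : Parallel cs t r := by
  refine ⟨?_, fun u v hu hv => ?_, fun u v hu hv => ?_⟩
  · rintro rfl
    obtain ⟨w, i, rfl⟩ := id hδ
    have hw : rep cs w⁻¹ (rep cs w (simpleRoot i)) = simpleRoot i := rep_inv_rep cs w _
    have h1 := h.nonpos_of_inWallBar hα hδ hne ht (v := w)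
      ((inWallBar_iff hδ hr w).2 ⟨i, Or.inl hw⟩)
    rw [hw] at h1
    exact (isRoot_simpleRoot (cs := cs) i).not_nonpos (simpleRoot_nonneg i) h1
  · have h1 := (hα.map_rep _).not_nonpos (h.nonneg_of_inWallBar hα hδ hne hr hu)
    have h2 := (hα.map_rep _).not_nonpos (h.nonneg_of_inWallBar hα hδ hne hr hv)
    rw [sameSide_iff hα ht]
    exact iff_of_false h1 h2
  · rw [sameSide_iff hδ hr]
    exact iff_of_true (h.nonpos_of_inWallBar hα hδ hne ht hu)
      (h.nonpos_of_inWallBar hα hδ hne ht hv)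

theorem Parallel.symm {t r : W} (h : Parallel cs t r) : Parallel cs r t :=
  ⟨h.1.symm, h.2.2, h.2.1⟩

theorem Dom.sepWallFromPt {α δ : B → ℝ} (hα : IsRoot cs α) (hδ : IsRoot cs δ)
    (h : Dom cs α δ) (hne : δ ≠ α) {t r : W} (ht : rep cs t = refl M α)
    (hr : rep cs r = refl M δ) {p : W} (hp : 0 ≤ rep cs p⁻¹ δ) : SepWallFromPt cs r t p := by
  intro v hv hs
  rw [sameSide_iff hδ hr] at hs
  exact (hδ.map_rep _).not_nonpos hp (hs.1 (h.nonpos_of_inWallBar hα hδ hne ht hv))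

theorem Dom.antisymm {α δ : B → ℝ} (hα : IsRoot cs α) (hδ : IsRoot cs δ)
    (h1 : Dom cs α δ) (h2 : Dom cs δ α) : α = δ := by
  by_contra hne
  obtain ⟨t, -, ht⟩ := hα.exists_reflection
  obtain ⟨w, i, rfl⟩ := id hα
  have hw : rep cs w⁻¹ (rep cs w (simpleRoot i)) = simpleRoot i := rep_inv_rep cs w _
  have h3 := h2 w (h1.nonpos_of_inWallBar hα hδ (Ne.symm hne) ht
    ((inWallBar_iff hα ht w).2 ⟨i, Or.inl hw⟩))
  rw [hw] at h3
  exact (isRoot_simpleRoot (cs := cs) i).not_nonpos (simpleRoot_nonneg i) h3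

theorem dom_or_dom {γ δ : B → ℝ} (hγ : IsRoot cs γ) (hδ : IsRoot cs δ) (h : 1 ≤ form M γ δ) :
    Dom cs γ δ ∨ Dom cs δ γ := by
  by_contra! hc
  obtain ⟨h1, h2⟩ := hc
  simp only [Dom, not_forall] at h1 h2
  obtain ⟨v, hv1, hv2⟩ := h1
  obtain ⟨u, hu1, hu2⟩ := h2
  exact hγ.not_cross hδ h ((hγ.map_rep _).not_nonpos_iff.1 hu2) hu1 hv1
    ((hδ.map_rep _).not_nonpos_iff.1 hv2)

theorem dom_simpleRoot {α : B → ℝ} (hα : IsRoot cs α) (h0 : 0 ≤ α) {s : B}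
    (h : 1 ≤ form M α (simpleRoot s)) : Dom cs α (simpleRoot s) := by
  by_cases hs : α = simpleRoot s
  · rw [hs]; exact fun v hv => hv
  intro v hv
  by_contra hc
  refine hα.not_cross (isRoot_simpleRoot s) h (u := cs.simple s) (v := v) ?_ ?_ hv
    (((isRoot_simpleRoot s).map_rep _).not_nonpos_iff.1 hc)
  · rw [cs.inv_simple]
    exact hα.rep_simple_nonneg h0 hs
  · rw [cs.inv_simple, rep_simple, refl_self M (form_simpleRoot_self M s)]
    exact neg_nonpos.2 (simpleRoot_nonneg s)

variable (cs) in
/-- The least length of an element making the root `α` nonpositive. -/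
noncomputable def depth (α : B → ℝ) : ℕ := sInf {n | ∃ w, rep cs w⁻¹ α ≤ 0 ∧ cs.length w = n}

theorem depth_le {α : B → ℝ} {w : W} (h : rep cs w⁻¹ α ≤ 0) : depth cs α ≤ cs.length w :=
  Nat.sInf_le ⟨w, h, rfl⟩

theorem IsRoot.exists_length_eq_depth {α : B → ℝ} (h : IsRoot cs α) :
    ∃ w, rep cs w⁻¹ α ≤ 0 ∧ cs.length w = depth cs α := by
  refine Nat.sInf_mem (s := {n | ∃ w, rep cs w⁻¹ α ≤ 0 ∧ cs.length w = n}) ?_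
  obtain ⟨w, i, rfl⟩ := h
  refine ⟨_, w * cs.simple i, ?_, rfl⟩
  rw [mul_inv_rev, cs.inv_simple, rep_mul_apply, rep_inv_rep, rep_simple,
    refl_self M (form_simpleRoot_self M i)]
  exact neg_nonpos.2 (simpleRoot_nonneg i)

theorem rep_inv_eq_simpleRoot {α : B → ℝ} (h : IsRoot cs α) (h0 : 0 ≤ α) {w : W}
    (hw : rep cs w⁻¹ α ≤ 0) (hl : cs.length w = depth cs α) :
    ∃ j, rep cs (w * cs.simple j)⁻¹ α = simpleRoot j ∧
      cs.length (w * cs.simple j) + 1 = depth cs α := by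
  have hw1 : w ≠ 1 := by
    rintro rfl
    exact h.not_nonpos h0 (by simpa using hw)
  obtain ⟨j, hj⟩ := cs.exists_rightDescent_of_ne_one hw1
  rw [cs.isRightDescent_iff] at hj
  refine ⟨j, (h.map_rep _).eq_simpleRoot ?_ ?_, by omega⟩
  · rw [← (h.map_rep _).not_nonpos_iff]
    intro hc
    have := depth_le hc
    omega
  · rw [← rep_mul_apply, mul_inv_rev, cs.inv_simple, cs.simple_mul_simple_cancel_left]
    exact hw

theorem depth_simpleRoot_le (i : B) : depth cs (simpleRoot i) ≤ 1 := by
  rw [← cs.length_simple i]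
  apply depth_le
  rw [cs.inv_simple, rep_simple, refl_self M (form_simpleRoot_self M i)]
  exact neg_nonpos.2 (simpleRoot_nonneg i)

theorem depth_le_depth_rep_simple_add_one {α : B → ℝ} (h : IsRoot cs α) (s : B) :
    depth cs α ≤ depth cs (rep cs (cs.simple s) α) + 1 := by
  obtain ⟨w, hw, hl⟩ := (h.map_rep (cs.simple s)).exists_length_eq_depth
  have h1 := depth_le (cs := cs) (w := cs.simple s * w) (α := α)
    (by rwa [mul_inv_rev, cs.inv_simple, rep_mul_apply])
  have := cs.length_simple_mul w s
  omega

theorem depth_rep_simple {α : B → ℝ} (h : IsRoot cs α) (h0 : 0 ≤ α) {s : B}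
    (hs : α ≠ simpleRoot s) (hc : 0 < form M α (simpleRoot s)) :
    depth cs (rep cs (cs.simple s) α) + 1 = depth cs α := by
  refine le_antisymm ?_ (depth_le_depth_rep_simple_add_one h s)
  obtain ⟨w, hw, hl⟩ := h.exists_length_eq_depth
  rcases cs.length_simple_mul w s with hsw | hsw
  · obtain ⟨j, hj, hl'⟩ := rep_inv_eq_simpleRoot h h0 hw hl
    suffices rep cs (w * cs.simple j)⁻¹ (rep cs (cs.simple s) α) ≤ 0 by
      have := depth_le this
      omega
    by_contra hneg
    rw [((h.map_rep _).map_rep _).not_nonpos_iff, rep_simple, refl_apply, map_sub, map_smul, hj,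
      form_comm] at hneg
    set σ := rep cs (w * cs.simple j)⁻¹ (simpleRoot s) with hσ
    have hσr : IsRoot cs σ := (isRoot_simpleRoot s).map_rep _
    have hform : form M (simpleRoot j) σ = form M α (simpleRoot s) := by
      rw [← hj, hσ, form_rep_rep]
    have hρ : 0 ≤ rep cs (cs.simple j) σ := by
      rw [hσ, ← rep_mul_apply, mul_inv_rev, cs.inv_simple, cs.simple_mul_simple_cancel_left]
      apply rep_simpleRoot_nonneg
      rw [← cs.length_inv (w⁻¹ * _), mul_inv_rev, cs.inv_simple, inv_inv, cs.length_inv]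
      omega
    rcases hσr.nonneg_or_nonpos with hσ0 | hσ0
    · have : σ = simpleRoot j := by
        refine hσr.eq_simpleRoot_of_forall_ne hσ0 fun k hk => ?_
        have h1 := hneg k
        have h2 := hσ0 k
        simp only [simpleRoot, Pi.zero_apply, Pi.sub_apply, Pi.smul_apply, smul_eq_mul,
          Pi.single_eq_of_ne hk, zero_sub] at h1 h2 hc
        nlinarith
      apply hs
      rw [← rep_rep_inv cs (w * cs.simple j) α, hj, ← this, hσ, rep_rep_inv]
    · have : -σ = simpleRoot j := hσr.neg.eq_simpleRoot (neg_nonneg.2 hσ0)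
        (by rw [map_neg]; exact neg_nonpos.2 hρ)
      rw [← neg_neg σ, this, map_neg, form_simpleRoot_self] at hform
      linarith
  · have := depth_le (cs := cs) (w := cs.simple s * w) (α := rep cs (cs.simple s) α)
      (by rwa [← rep_mul_apply, mul_inv_rev, cs.inv_simple, mul_assoc,
        cs.simple_mul_simple_self, mul_one])
    omega

theorem wallDist_one_le_depth {α : B → ℝ} (h : IsRoot cs α) (h0 : 0 ≤ α) {t : W}
    (ht : rep cs t = refl M α) : wallDist cs t 1 ≤ depth cs α := by
  obtain ⟨w, hw, hl⟩ := h.exists_length_eq_depth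
  obtain ⟨j, hj, -⟩ := rep_inv_eq_simpleRoot h h0 hw hl
  refine Nat.sInf_le ⟨w, (inWallBar_iff h ht w).2 ⟨j, Or.inr ?_⟩, by simpa [d] using hl⟩
  rw [mul_inv_rev, cs.inv_simple, rep_mul_apply, rep_simple] at hj
  rw [← refl_refl M (form_simpleRoot_self M j) (rep cs w⁻¹ α), hj,
    refl_self M (form_simpleRoot_self M j)]

theorem exists_form_simpleRoot_pos {α : B → ℝ} (h : IsRoot cs α) (h0 : 0 ≤ α) :
    ∃ s, 0 < form M α (simpleRoot s) := by
  by_contra! hc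
  have h1 : form M α (∑ i, α i • simpleRoot i) = ∑ i, α i * form M α (simpleRoot i) := by
    simp [map_sum]
  rw [← eq_sum_simpleRoot, h.form_self] at h1
  have h2 : ∑ i, α i * form M α (simpleRoot i) ≤ 0 :=
    Finset.sum_nonpos fun i _ => mul_nonpos_of_nonneg_of_nonpos (h0 i) (hc i)
  linarith

variable (cs) in
/-- The positive roots strictly dominated by `α`. -/
def domSet (α : B → ℝ) : Set (B → ℝ) := {δ | IsRoot cs δ ∧ 0 ≤ δ ∧ δ ≠ α ∧ Dom cs α δ}

theorem finite_domSet {α : B → ℝ} (h : IsRoot cs α) : (domSet cs α).Finite := by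
  obtain ⟨w, hw, -⟩ := h.exists_length_eq_depth
  exact (finite_setOf_nonneg_nonpos w).subset fun δ hδ => ⟨hδ.1, hδ.2.1, hδ.2.2.2 w hw⟩

theorem depth_le_of_dom {α δ : B → ℝ} (h : IsRoot cs α) (hd : Dom cs α δ) :
    depth cs δ ≤ depth cs α := by
  obtain ⟨w, hw, hl⟩ := h.exists_length_eq_depth
  rw [← hl]
  exact depth_le (hd w hw)

theorem image_domSet_subset {α : B → ℝ} (h : IsRoot cs α) (h0 : 0 ≤ α) {s : B}
    (hs : α ≠ simpleRoot s) (hc : 0 < form M α (simpleRoot s)) :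
    rep cs (cs.simple s) '' domSet cs (rep cs (cs.simple s) α) ⊆
      domSet cs α \ {simpleRoot s} := by
  rintro _ ⟨δ, ⟨h1, h2, h3, h4⟩, rfl⟩
  have hss : ∀ v, rep cs (cs.simple s) (rep cs (cs.simple s) v) = v := fun v => by
    rw [← rep_mul_apply, cs.simple_mul_simple_self, map_one, Module.End.one_apply]
  refine ⟨⟨h1.map_rep _, h1.rep_simple_nonneg h2 ?_, ?_, ?_⟩, ?_⟩
  · rintro rfl
    obtain ⟨w, hw, hl⟩ := (h.map_rep (cs.simple s)).exists_length_eq_depth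
    have h5 := length_reflection_mul_lt h1 (rep_simple cs s) h2 (h4 w hw)
    have h6 := depth_le (cs := cs) (w := cs.simple s * w) (α := α)
      (by rwa [mul_inv_rev, cs.inv_simple, rep_mul_apply])
    have := depth_rep_simple h h0 hs hc
    omega
  · intro h5
    apply h3
    rw [← h5, hss]
  · have := h4.map_rep (cs.simple s)
    rwa [hss] at this
  · intro h5
    rw [Set.mem_singleton_iff] at h5
    have h6 := hss δ
    rw [h5, rep_simple, refl_self M (form_simpleRoot_self M s)] at h6
    rw [← h6, neg_nonneg] at h2
    exact (isRoot_simpleRoot (cs := cs) s).not_nonpos (simpleRoot_nonneg s) h2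

theorem ncard_domSet_rep_simple_le {α : B → ℝ} (h : IsRoot cs α) (h0 : 0 ≤ α) {s : B}
    (hs : α ≠ simpleRoot s) (hc : 0 < form M α (simpleRoot s)) :
    (domSet cs (rep cs (cs.simple s) α)).ncard ≤ (domSet cs α \ {simpleRoot s}).ncard := by
  have hinj : Function.Injective (rep cs (cs.simple s)) := fun u v huv => by
    rw [← rep_inv_rep cs (cs.simple s) u, huv, rep_inv_rep]
  rw [← Set.ncard_image_of_injective _ hinj]
  exact Set.ncard_le_ncard (image_domSet_subset h h0 hs hc) ((finite_domSet h).sdiff)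

theorem exists_descent (hB : ∃ α, IsRoot cs α) :
    ∃ f : (B → ℝ) → B, ∀ α, IsRoot cs α → 0 ≤ α → 0 < form M α (simpleRoot (f α)) := by
  obtain ⟨_, _, i, -⟩ := hB
  have : Nonempty B := ⟨i⟩
  have h : ∀ α, ∃ s, IsRoot cs α → 0 ≤ α → 0 < form M α (simpleRoot s) := by
    intro α
    by_cases hα : IsRoot cs α ∧ 0 ≤ α
    · obtain ⟨s, hs⟩ := exists_form_simpleRoot_pos hα.1 hα.2
      exact ⟨s, fun _ _ => hs⟩
    · exact ⟨i, fun h1 h2 => absurd ⟨h1, h2⟩ hα⟩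
  choose f hf using h
  exact ⟨f, hf⟩

/-- A sequence of positive roots of decreasing depth starting at a given positive root. -/
theorem IsRoot.exists_descending_seq {α : B → ℝ} (h : IsRoot cs α) (h0 : 0 ≤ α) :
    ∃ (a : ℕ → B → ℝ) (s : ℕ → B), a 0 = α ∧ (∀ k, a (k + 1) = rep cs (cs.simple (s k)) (a k)) ∧
      (∀ k, IsRoot cs (a k)) ∧
      ∀ k, k < depth cs α → 0 ≤ a k ∧ depth cs (a k) + k = depth cs α ∧
        0 < form M (a k) (simpleRoot (s k)) ∧ (k + 1 < depth cs α → a k ≠ simpleRoot (s k)) := by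
  obtain ⟨f, hf⟩ := exists_descent ⟨α, h⟩
  let a : ℕ → B → ℝ := fun k => (fun γ => rep cs (cs.simple (f γ)) γ)^[k] α
  have ha : ∀ k, a (k + 1) = rep cs (cs.simple (f (a k))) (a k) := fun k =>
    Function.iterate_succ_apply' _ _ _
  have hroot : ∀ k, IsRoot cs (a k) := by
    intro k
    induction k with
    | zero => exact h
    | succ k ih => rw [ha]; exact ih.map_rep _
  have hne : ∀ k, depth cs (a k) + k = depth cs α → k + 1 < depth cs α →
      a k ≠ simpleRoot (f (a k)) := by
    intro k hk hk1 heq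
    have := depth_simpleRoot_le (cs := cs) (f (a k))
    rw [← heq] at this
    omega
  have hpos : ∀ k, k < depth cs α → 0 ≤ a k ∧ depth cs (a k) + k = depth cs α := by
    intro k
    induction k with
    | zero => exact fun _ => ⟨h0, rfl⟩
    | succ k ih =>
      intro hk
      obtain ⟨h1, h2⟩ := ih (by omega)
      have h3 := hne k h2 hk
      rw [ha]
      refine ⟨(hroot k).rep_simple_nonneg h1 h3, ?_⟩
      have := depth_rep_simple (hroot k) h1 h3 (hf _ (hroot k) h1)
      omega
  refine ⟨a, fun k => f (a k), rfl, ha, hroot, fun k hk => ?_⟩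
  obtain ⟨h1, h2⟩ := hpos k hk
  exact ⟨h1, h2, hf _ (hroot k) h1, hne k h2⟩

/-- Truncation to the interval `[-1, 1]`. -/
noncomputable def clamp (x : ℝ) : ℝ := max (-1) (min 1 x)

theorem clamp_eq_of_mem {x : ℝ} (h1 : -1 < x) (h2 : x < 1) : clamp x = x := by
  rw [clamp, min_eq_right h2.le, max_eq_right h1.le]

theorem eq_of_clamp_eq {x y : ℝ} (h : clamp x = clamp y) (hx : x < 1) (hy : -1 < y) : x = y := by
  have hy1 : y < 1 := by
    by_contra! hc
    rw [clamp, clamp, min_eq_right hx.le, min_eq_left hc] at h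
    rcases max_choice (-1 : ℝ) x with h1 | h1 <;> rw [h1] at h <;> norm_num at h <;> linarith
  have hx1 : -1 < x := by
    by_contra! hc
    rw [clamp_eq_of_mem hy hy1, clamp, min_eq_right hx.le, max_eq_left hc] at h
    linarith
  rwa [clamp_eq_of_mem hx1 hx, clamp_eq_of_mem hy hy1] at h

variable (cs) in
/-- The possible truncated values of the form on pairs of roots. -/
def clampSet : Set ℝ :=
  {c | |c| < 1 ∧ ∃ γ δ, IsRoot cs γ ∧ IsRoot cs δ ∧ form M γ δ = c} ∪ {-1, 1}

theorem finite_clampSet : (clampSet cs).Finite :=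
  (finite_setOf_form cs).union (by simp)

theorem clamp_mem_clampSet {γ δ : B → ℝ} (hγ : IsRoot cs γ) (hδ : IsRoot cs δ) :
    clamp (form M γ δ) ∈ clampSet cs := by
  rcases le_or_gt (form M γ δ) (-1) with h1 | h1
  · right; left
    rw [clamp, max_eq_left]
    exact (min_le_right _ _).trans h1
  rcases le_or_gt 1 (form M γ δ) with h2 | h2
  · right; right
    rw [clamp, min_eq_left h2]
    norm_num
  · left
    rw [clamp_eq_of_mem h1 h2]
    exact ⟨abs_lt.2 ⟨h1, h2⟩, γ, δ, hγ, hδ, rfl⟩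

/-- Along a descending sequence with equal truncated labels at the two ends, the end roots
pair to one. -/
theorem form_eq_one_of_clamp_eq {a : ℕ → B → ℝ} {s : ℕ → B} {i j : ℕ} (hij : i ≤ j)
    (ha : ∀ k, a (k + 1) = rep cs (cs.simple (s k)) (a k)) (hroot : ∀ k, IsRoot cs (a k))
    (hpos : ∀ k, i ≤ k → k < j → 0 < form M (a k) (simpleRoot (s k)))
    (hlt : ∀ k, i ≤ k → k < j → form M (a k) (simpleRoot (s k)) < 1)
    (hL : ∀ r, clamp (form M (a i) (simpleRoot r)) = clamp (form M (a j) (simpleRoot r))) :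
    form M (a i) (a j) = 1 := by
  have hstep : ∀ k r, form M (a (k + 1)) (simpleRoot r) = form M (a k) (simpleRoot r) -
      2 * form M (a k) (simpleRoot (s k)) * form M (simpleRoot (s k)) (simpleRoot r) := by
    intro k r
    rw [ha, rep_simple, refl_apply, form_comm M (simpleRoot (s k)) (a k)]
    simp
  have hself : ∀ k, form M (a (k + 1)) (simpleRoot (s k)) = -form M (a k) (simpleRoot (s k)) := by
    intro k
    rw [hstep, form_simpleRoot_self]
    ring
  have hother : ∀ k r, i ≤ k → k < j → r ≠ s k →
      form M (a k) (simpleRoot r) ≤ form M (a (k + 1)) (simpleRoot r) := by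
    intro k r h1 h2 hr
    have h3 := hpos k h1 h2
    have h4 := form_simpleRoot_nonpos M hr.symm
    rw [hstep]
    nlinarith
  have hneg : ∀ k r, i ≤ k → -1 < form M (a k) (simpleRoot r) →
      ∀ l, k ≤ l → l ≤ j → -1 < form M (a l) (simpleRoot r) := by
    intro k r hik hk l hkl
    induction l, hkl using Nat.le_induction with
    | base => exact fun _ => hk
    | succ l hkl ih =>
      intro hlj
      by_cases hr : r = s l
      · subst hr
        rw [hself, neg_lt_neg_iff]
        exact hlt l (hik.trans hkl) hlj
      · exact (ih (Nat.le_of_succ_le hlj)).trans_le (hother l r (hik.trans hkl) hlj hr)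
  have hone : ∀ k r, i ≤ k → k ≤ j → 1 ≤ form M (a i) (simpleRoot r) →
      1 ≤ form M (a k) (simpleRoot r) := by
    intro k r hik
    induction k, hik using Nat.le_induction with
    | base => exact fun _ => id
    | succ l hil ih =>
      intro hlj h1
      have h2 := ih (by omega) h1
      refine h2.trans (hother l r hil hlj ?_)
      rintro rfl
      exact absurd h2 (not_le.2 (hlt l hil hlj))
  have heq : ∀ k, i ≤ k → k < j →
      form M (a i) (simpleRoot (s k)) = form M (a j) (simpleRoot (s k)) := by
    intro k hik hkj
    refine eq_of_clamp_eq (hL _) ?_ ?_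
    · by_contra! hc
      exact absurd (hone k _ hik hkj.le hc) (not_le.2 (hlt k hik hkj))
    · refine hneg (k + 1) _ (by omega) ?_ j (by omega) le_rfl
      rw [hself, neg_lt_neg_iff]
      exact hlt k hik hkj
  have hzero : ∀ k, i ≤ k → k ≤ j → form M (a i - a k) (a i - a j) = 0 := by
    intro k hik
    induction k, hik using Nat.le_induction with
    | base => simp
    | succ l hil ih =>
      intro hlj
      have h1 := ih (by omega)
      have h2 := heq l hil hlj
      have h3 : form M (simpleRoot (s l)) (a i - a j) = 0 := by
        rw [form_comm, map_sub, LinearMap.sub_apply, h2, sub_self]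
      rw [ha, rep_simple, refl_apply, ← sub_add, map_add, LinearMap.add_apply, h1, map_smul,
        LinearMap.smul_apply, h3, smul_zero, add_zero]
  have h1 := hzero j hij le_rfl
  simp only [map_sub, LinearMap.sub_apply, (hroot i).form_self, (hroot j).form_self,
    form_comm M (a j) (a i)] at h1
  linarith

theorem not_dom_of_depth_lt {α δ : B → ℝ} (h : IsRoot cs δ) (hd : depth cs δ < depth cs α) :
    ¬ Dom cs δ α := fun hdom => by
  have := depth_le_of_dom h hdom
  omega

theorem ncard_domSet_lt {α δ : B → ℝ} (hα : IsRoot cs α) (hδ : IsRoot cs δ) (h0 : 0 ≤ δ)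
    (hd : depth cs δ < depth cs α) (h : Dom cs α δ) :
    (domSet cs δ).ncard < (domSet cs α).ncard := by
  refine Set.ncard_lt_ncard ⟨?_, fun hsub => ?_⟩ (finite_domSet hα)
  · rintro ε ⟨h1, h2, h3, h4⟩
    refine ⟨h1, h2, ?_, h.trans h4⟩
    rintro rfl
    exact not_dom_of_depth_lt hδ hd h4
  · exact (hsub (show δ ∈ domSet cs α from ⟨hδ, h0, by rintro rfl; omega, h⟩)).2.2.1 rfl

/-- Roots of large depth dominate many positive roots. -/
theorem exists_le_ncard_domSet (cs : CoxeterSystem M W) (m : ℕ) :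
    ∃ N, ∀ α, IsRoot cs α → 0 ≤ α → N ≤ depth cs α → m ≤ (domSet cs α).ncard := by
  induction m with
  | zero => exact ⟨0, fun _ _ _ _ => Nat.zero_le _⟩
  | succ m ih =>
    obtain ⟨N, hN⟩ := ih
    have hfin : {L : B → ℝ | ∀ r, L r ∈ clampSet cs}.Finite :=
      Set.Finite.pi' fun _ => finite_clampSet
    set C := hfin.toFinset.card with hC
    refine ⟨N + C + 2, fun α hα h0 hdepth => ?_⟩
    by_contra! hcard
    obtain ⟨a, s, ha0, ha, hroot, hseq⟩ := hα.exists_descending_seq h0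
    have hle : ∀ k, k < C + 1 → (domSet cs (a (k + 1))).ncard ≤
        (domSet cs (a k) \ {simpleRoot (s k)}).ncard := by
      intro k hk
      obtain ⟨h1, -, h2, h3⟩ := hseq k (by omega)
      rw [ha]
      exact ncard_domSet_rep_simple_le (hroot k) h1 (h3 (by omega)) h2
    have hle' : ∀ k, k ≤ C + 1 → (domSet cs (a k)).ncard ≤ m := by
      intro k
      induction k with
      | zero => intro _; rw [ha0]; omega
      | succ k ih =>
        intro hk
        exact ((hle k hk).trans (Set.ncard_le_ncard Set.sdiff_subset (finite_domSet (hroot k)))).trans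
          (ih (by omega))
    have heq : ∀ k, k ≤ C + 1 → (domSet cs (a k)).ncard = m := by
      intro k hk
      obtain ⟨h1, h2, -⟩ := hseq k (by omega)
      exact le_antisymm (hle' k hk) (hN _ (hroot k) h1 (by omega))
    have hlt : ∀ k, k < C + 1 → form M (a k) (simpleRoot (s k)) < 1 := by
      intro k hk
      by_contra! hc
      obtain ⟨h1, -, -, h3⟩ := hseq k (by omega)
      have h4 : simpleRoot (s k) ∈ domSet cs (a k) :=
        ⟨isRoot_simpleRoot _, simpleRoot_nonneg _, (h3 (by omega)).symm,
          dom_simpleRoot (hroot k) h1 hc⟩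
      have h5 := hle k hk
      have h6 := Set.ncard_sdiff_singleton_lt_of_mem h4 (finite_domSet (hroot k))
      rw [heq k hk.le] at h6
      rw [heq (k + 1) hk] at h5
      omega
    obtain ⟨i, hi, j, hj, hne, hL⟩ := Finset.exists_ne_map_eq_of_card_lt_of_maps_to
      (s := Finset.range (C + 1)) (t := hfin.toFinset)
      (f := fun k r => clamp (form M (a k) (simpleRoot r))) (by simp [hC]) (by
        intro k _
        simp only [Set.Finite.coe_toFinset, Set.mem_ofPred_eq]
        exact fun r => clamp_mem_clampSet (hroot k) (isRoot_simpleRoot r))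
    rw [Finset.mem_range] at hi hj
    wlog hij : i < j generalizing i j
    · exact this j hj i hi hne.symm hL.symm (by omega)
    have hform := form_eq_one_of_clamp_eq hij.le ha hroot
      (fun k _ hk => (hseq k (by omega)).2.2.1) (fun k _ hk => hlt k (by omega))
      (fun r => congrFun hL r)
    have h1 := (hseq i (by omega)).2.1
    have h2 := (hseq j (by omega)).2.1
    rcases dom_or_dom (hroot i) (hroot j) hform.ge with hd | hd
    · have := ncard_domSet_lt (hroot i) (hroot j) (hseq j (by omega)).1 (by omega) hd
      rw [heq i (by omega), heq j (by omega)] at this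
      exact lt_irrefl _ this
    · exact not_dom_of_depth_lt (hroot j) (by omega) hd

theorem finite_setOf_length_lt (cs : CoxeterSystem M W) (n : ℕ) :
    {w : W | cs.length w < n}.Finite := by
  refine ((List.finite_length_lt B n).image cs.wordProd).subset fun w hw => ?_
  obtain ⟨ω, hω, rfl⟩ := cs.exists_isReduced w
  exact ⟨ω, by rwa [Set.mem_ofPred_eq, hω.eq] at hw, rfl⟩

theorem finite_setOf_depth_lt (cs : CoxeterSystem M W) (n : ℕ) :
    {α : B → ℝ | IsRoot cs α ∧ 0 ≤ α ∧ depth cs α < n}.Finite := by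
  refine ((finite_setOf_length_lt cs n).biUnion fun w _ =>
    finite_setOf_nonneg_nonpos (cs := cs) w).subset ?_
  rintro α ⟨h1, h2, h3⟩
  obtain ⟨w, hw, hl⟩ := h1.exists_length_eq_depth
  exact Set.mem_biUnion (show cs.length w < n by omega) ⟨h1, h2, hw⟩

/-- Roots of large depth dominate long chains of positive roots. -/
theorem exists_dom_chain (cs : CoxeterSystem M W) (n : ℕ) :
    ∃ P, ∀ α, IsRoot cs α → 0 ≤ α → P ≤ depth cs α →
      ∃ T : Finset (B → ℝ), T.card = n ∧ ↑T ⊆ domSet cs α ∧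
        ∀ δ ∈ T, ∀ ε ∈ T, Dom cs δ ε ∨ Dom cs ε δ := by
  induction n with
  | zero => exact ⟨0, fun _ _ _ _ => ⟨∅, by simp⟩⟩
  | succ n ih =>
    obtain ⟨P, hP⟩ := ih
    obtain ⟨N, hN⟩ := exists_le_ncard_domSet cs
      ({α : B → ℝ | IsRoot cs α ∧ 0 ≤ α ∧ depth cs α < P}.ncard + 1)
    refine ⟨N, fun α hα h0 hd => ?_⟩
    obtain ⟨δ, hδ, hδP⟩ : ∃ δ ∈ domSet cs α, P ≤ depth cs δ := by
      by_contra! hc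
      have h1 := Set.ncard_le_ncard (s := domSet cs α)
        (t := {α : B → ℝ | IsRoot cs α ∧ 0 ≤ α ∧ depth cs α < P})
        (fun δ hδ => ⟨hδ.1, hδ.2.1, hc δ hδ⟩) (finite_setOf_depth_lt cs P)
      have h2 := hN α hα h0 hd
      omega
    obtain ⟨T, hT, hsub, hcomp⟩ := hP δ hδ.1 hδ.2.1 hδP
    classical
    refine ⟨insert δ T, ?_, ?_, ?_⟩
    · rw [Finset.card_insert_of_notMem fun h => (hsub h).2.2.1 rfl, hT]
    · rw [Finset.coe_insert, Set.insert_subset_iff]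
      refine ⟨hδ, fun ε hε => ?_⟩
      obtain ⟨h1, h2, h3, h4⟩ := hsub hε
      refine ⟨h1, h2, ?_, hδ.2.2.2.trans h4⟩
      rintro rfl
      exact h3 (Dom.antisymm h1 hδ.1 hδ.2.2.2 h4)
    · intro ε hε ε' hε'
      rw [Finset.mem_insert] at hε hε'
      rcases hε with rfl | hε <;> rcases hε' with rfl | hε'
      · exact Or.inl fun v hv => hv
      · exact Or.inl (hsub hε').2.2.2
      · exact Or.inr (hsub hε).2.2.2
      · exact hcomp _ hε _ hε'

theorem wallDist_conj (t p : W) : wallDist cs (p⁻¹ * t * p) 1 = wallDist cs t p := by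
  unfold wallDist
  congr 1
  ext n
  constructor
  · rintro ⟨v, ⟨i, hi⟩, hv⟩
    refine ⟨p * v, ⟨i, ?_⟩, by simpa [d] using hv⟩
    rw [mul_assoc p v, ← hi]
    group
  · rintro ⟨v, ⟨i, hi⟩, hv⟩
    refine ⟨p⁻¹ * v, ⟨i, ?_⟩, by simpa [d] using hv⟩
    rw [mul_assoc p⁻¹ v, ← hi]
    group

theorem exists_isParallelWallFn (cs : CoxeterSystem M W) : ∃ P : ℕ → ℕ, IsParallelWallFn cs P := by
  choose P hP using exists_dom_chain cs
  refine ⟨P, fun n _ t p ht hdist => ?_⟩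
  obtain ⟨α, hα, htα, hαp⟩ : ∃ α, IsRoot cs α ∧ rep cs t = refl M α ∧ 0 ≤ rep cs p⁻¹ α := by
    obtain ⟨α, hα, htα⟩ := exists_isRoot ht
    rcases (hα.map_rep p⁻¹).nonneg_or_nonpos with h | h
    · exact ⟨α, hα, htα, h⟩
    · exact ⟨-α, hα.neg, by rw [refl_neg, htα], by rw [map_neg]; exact neg_nonneg.2 h⟩
  have hconj : rep cs (p⁻¹ * t * p) = refl M (rep cs p⁻¹ α) := by
    simpa using rep_conj htα p⁻¹
  obtain ⟨T, hT, hsub, hcomp⟩ := hP n _ (hα.map_rep p⁻¹) hαp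
    (hdist.trans ((wallDist_conj t p).symm.le.trans
      (wallDist_one_le_depth (hα.map_rep _) hαp hconj)))
  have hex : ∀ δ : B → ℝ, ∃ r, IsRoot cs δ → cs.IsReflection r ∧ rep cs r = refl M δ := fun δ => by
    by_cases hδ : IsRoot cs δ
    · obtain ⟨r, hr⟩ := hδ.exists_reflection
      exact ⟨r, fun _ => hr⟩
    · exact ⟨1, fun h => absurd h hδ⟩
  choose R hR using hex
  have hR' : ∀ δ ∈ T, cs.IsReflection (R (rep cs p δ)) ∧
      rep cs (R (rep cs p δ)) = refl M (rep cs p δ) := fun δ hδ =>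
    hR _ ((hsub hδ).1.map_rep p)
  have hinj : Function.Injective (rep cs p) := fun u v huv => by
    rw [← rep_inv_rep cs p u, huv, rep_inv_rep]
  have hpar : ∀ δ ∈ T, ∀ ε ∈ T, δ ≠ ε → Parallel cs (R (rep cs p δ)) (R (rep cs p ε)) := by
    intro δ hδ ε hε hne
    have h1 := (hsub hδ).1.map_rep p
    have h2 := (hsub hε).1.map_rep p
    rcases hcomp δ hδ ε hε with h | h
    · exact (h.map_rep p).parallel h1 h2 (hinj.ne hne.symm) (hR' δ hδ).2 (hR' ε hε).2
    · exact ((h.map_rep p).parallel h2 h1 (hinj.ne hne) (hR' ε hε).2 (hR' δ hδ).2).symm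
  classical
  refine ⟨T.image fun δ => R (rep cs p δ), ?_, ?_, ?_, ?_⟩
  · rw [Finset.card_image_of_injOn, hT]
    intro δ hδ ε hε heq
    by_contra hne
    exact (hpar δ hδ ε hε hne).1 heq
  · simp only [Finset.mem_image]
    rintro _ ⟨δ, hδ, rfl⟩
    exact (hR' δ hδ).1
  · simp only [Finset.mem_image]
    rintro _ ⟨δ, hδ, rfl⟩ _ ⟨ε, hε, rfl⟩ hne
    exact hpar δ hδ ε hε fun h => hne (by rw [h])
  · simp only [Finset.mem_image]
    rintro _ ⟨δ, hδ, rfl⟩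
    obtain ⟨h1, h2, h3, h4⟩ := hsub hδ
    have h5 := h4.map_rep p
    rw [rep_rep_inv] at h5
    refine h5.sepWallFromPt hα (h1.map_rep p) ?_ htα (hR' δ hδ).2 ?_
    · rintro rfl
      exact h3 (rep_inv_rep cs p δ).symm
    · rwa [rep_inv_rep]

end Auxiliary

/-- **Parallel Wall Theorem** (Brink–Howlett). For each positive integer `n` there is a
constant `P n` such that: for every wall `Q` (with reflection `t`) and every vertex `p`
whose distance from `Q̄` is at least `P n`, there exist `n` distinct pairwise parallel
walls each of which separates `Q̄` from `p`. -/
theorem parallel_wall_theorem {B : Type*} {W : Type*} [Group W] [Finite B]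
    {M : CoxeterMatrix B} (cs : CoxeterSystem M W) :
    ∃ P : ℕ → ℕ, IsParallelWallFn cs P := by
  cases nonempty_fintype B
  classical
  exact exists_isParallelWallFn cs

end CoxTrack
end

section
/- Let (W,S) be a finitely generated Coxeter system with Cayley graph Λ(W,S), and let P be a Parallel Wall function for (W,S). Suppose α = (e₁, …, eₙ) is a geodesic edge path connecting vertices a and b in Λ that does not cross the wall Q. If e₀ is an edge at a and e_{n+1} is an edge at b such that e₀ and e_{n+1} both belong to the wall Q, then every vertex of α is within distance P(1) of Q̄. In particular, if v is a vertex of α and v′ = tv is the reflection of v across Q (where t is the reflection of Q), then d(v, v′) ≤ 2P(1) + 1. -/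
/-!
Common definitions: Cayley graph of a Coxeter system, walls, sides,
bracket numbers, edge paths, quasi-geodesics, tracking.
-/

namespace CoxTrack

variable {B : Type*} {W : Type*} [Group W] {M : CoxeterMatrix B}

section ReflectionCocycle

variable (cs : CoxeterSystem M W)

open Classical in
/-- The action of the `i`-th simple reflection on `W × ZMod 2`: conjugation in the first
coordinate, with the second coordinate flipped exactly at the simple reflection itself. -/
noncomputable def signedConj (i : B) : Function.End (W × ZMod 2) := fun x =>
  (cs.simple i * x.1 * cs.simple i, x.2 + if x.1 = cs.simple i then 1 else 0)

theorem conj_eq_iff_of_inverts {p s : W} (hp : s * p = p⁻¹ * s) (k : ℕ) (x : W) :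
    p ^ k * x * (p ^ k)⁻¹ = s ↔ x = (p ^ (2 * k))⁻¹ * s := by
  have h : ∀ k : ℕ, s * p ^ k = (p ^ k)⁻¹ * s := by
    intro k
    have := (SemiconjBy.pow_right (show SemiconjBy s p p⁻¹ from hp) k).eq
    rwa [inv_pow] at this
  rw [mul_inv_eq_iff_eq_mul, h, ← eq_inv_mul_iff_mul_eq, two_mul, pow_add, mul_inv_rev, mul_assoc]

open Classical in
theorem signedConj_mul_pow_apply (i j : B) (k : ℕ) (x : W × ZMod 2) :
    ((signedConj cs i * signedConj cs j) ^ k) x =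
      ((cs.simple i * cs.simple j) ^ k * x.1 * ((cs.simple i * cs.simple j) ^ k)⁻¹,
        x.2 + ∑ l ∈ Finset.range (2 * k),
          if x.1 = ((cs.simple i * cs.simple j) ^ l)⁻¹ * cs.simple j then 1 else 0) := by
  induction k with
  | zero => simp; rfl
  | succ k ih =>
    set p := cs.simple i * cs.simple j with hp
    have hsp : cs.simple j * p = p⁻¹ * cs.simple j := by
      simp [hp, mul_assoc]
    have hpi : p⁻¹ = cs.simple j * cs.simple i := by simp [hp]
    have hstep : ∀ y : W × ZMod 2, (signedConj cs i * signedConj cs j) y =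
        (p * y.1 * p⁻¹, y.2 + (if y.1 = cs.simple j then 1 else 0) +
          if cs.simple j * y.1 * cs.simple j = cs.simple i then 1 else 0) := by
      intro y
      rw [hpi, hp]
      change signedConj cs i (signedConj cs j y) = _
      simp [signedConj, mul_assoc]
    have h₁ := conj_eq_iff_of_inverts hsp k x.1
    have h₂ : cs.simple j * (p ^ k * x.1 * (p ^ k)⁻¹) * cs.simple j = cs.simple i ↔
        x.1 = (p ^ (2 * k + 1))⁻¹ * cs.simple j := by
      have hq : cs.simple i = cs.simple j * (p⁻¹ * cs.simple j) * cs.simple j := by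
        simp [hp, mul_assoc]
      conv_lhs => rw [hq]
      rw [mul_left_inj, mul_right_inj, mul_inv_eq_iff_eq_mul, mul_assoc,
        (show SemiconjBy (cs.simple j) (p ^ k) ((p ^ k)⁻¹) by
          rw [← inv_pow]; exact SemiconjBy.pow_right hsp k).eq, ← eq_inv_mul_iff_mul_eq]
      rw [show (p ^ (2 * k + 1))⁻¹ = (p ^ k)⁻¹ * (p⁻¹ * (p ^ k)⁻¹) by
        rw [← mul_inv_rev, ← mul_inv_rev, ← pow_succ, ← pow_add]
        congr 2; omega]
      simp only [mul_assoc]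
    rw [pow_succ']
    change (signedConj cs i * signedConj cs j) (((signedConj cs i * signedConj cs j) ^ k) x) = _
    rw [ih, hstep, show 2 * (k + 1) = 2 * k + 1 + 1 by ring, Finset.sum_range_succ,
      Finset.sum_range_succ]
    simp only [h₁, h₂]
    simp only [pow_succ' p k, mul_inv_rev, mul_assoc, add_assoc]

theorem signedConj_isLiftable : M.IsLiftable (signedConj cs) := by
  classical
  intro i j
  funext x
  rw [signedConj_mul_pow_apply, two_mul, Finset.sum_range_add]
  simp [pow_add, CharTwo.add_self_eq_zero]
  rfl

/-- The action of `W` on `W × ZMod 2` extending `signedConj`. -/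
noncomputable def signedConjHom : W →* Function.End (W × ZMod 2) :=
  cs.lift ⟨signedConj cs, signedConj_isLiftable cs⟩

theorem signedConjHom_simple (i : B) : signedConjHom cs (cs.simple i) = signedConj cs i :=
  cs.lift_apply_simple (signedConj_isLiftable cs) i

theorem signedConjHom_mul_apply (u w : W) (x : W × ZMod 2) :
    signedConjHom cs (u * w) x = signedConjHom cs u (signedConjHom cs w x) := by
  rw [map_mul]; rfl

theorem signedConjHom_one_apply (x : W × ZMod 2) : signedConjHom cs 1 x = x := by
  rw [map_one]; rfl

theorem signedConjHom_apply (w t : W) (e : ZMod 2) :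
    signedConjHom cs w (t, e) = (w * t * w⁻¹, e + (signedConjHom cs w (t, 0)).2) := by
  induction w using cs.simple_induction_left generalizing e with
  | one => simp [signedConjHom_one_apply]
  | mul_simple_left w i ih =>
    rw [signedConjHom_mul_apply, signedConjHom_mul_apply, ih e, ih 0, signedConjHom_simple]
    simp [signedConj, mul_assoc, add_assoc]

/-- The side of the wall of `t` containing `w`, as an element of `ZMod 2`. -/
noncomputable def side (t w : W) : ZMod 2 := (signedConjHom cs w⁻¹ (t, 0)).2

theorem side_one (t : W) : side cs t 1 = 0 := by
  simp [side, signedConjHom_one_apply]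

open Classical in
theorem side_mul_simple (t w : W) (i : B) :
    side cs t (w * cs.simple i) =
      side cs t w + if t * w = w * cs.simple i then 1 else 0 := by
  have h : w⁻¹ * t * w = cs.simple i ↔ t * w = w * cs.simple i := by
    rw [mul_assoc, inv_mul_eq_iff_eq_mul]
  have hfst : (signedConjHom cs w⁻¹ (t, 0)).1 = w⁻¹ * t * w := by
    rw [signedConjHom_apply, inv_inv]
  rw [side, mul_inv_rev, cs.inv_simple, signedConjHom_mul_apply, signedConjHom_simple]
  simp only [signedConj, side, hfst, h]

theorem side_reflection_mul {t : W} (ht : cs.IsReflection t) (w : W) :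
    side cs t (t * w) = side cs t w + 1 := by
  have htt : (signedConjHom cs t (t, 0)).2 = 1 := by
    obtain ⟨u, i, rfl⟩ := ht
    have h := congrArg Prod.snd (signedConjHom_mul_apply cs u u⁻¹ (u * cs.simple i * u⁻¹, 0))
    rw [mul_inv_cancel, signedConjHom_one_apply, signedConjHom_apply cs u⁻¹,
      signedConjHom_apply cs u] at h
    rw [mul_assoc u, signedConjHom_mul_apply, signedConjHom_mul_apply, ← mul_assoc u,
      signedConjHom_apply cs u⁻¹, signedConjHom_simple]
    simp only [signedConj, mul_assoc, inv_mul_cancel_left, inv_inv, inv_mul_cancel, mul_one,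
      cs.simple_mul_simple_self, zero_add, if_true] at h ⊢
    rw [signedConjHom_apply cs u]
    simp only
    rw [one_mul, add_right_comm, ← h, zero_add]
  rw [side, mul_inv_rev, ht.inv, signedConjHom_mul_apply, signedConjHom_apply cs t,
    mul_inv_cancel_right, zero_add, htt, signedConjHom_apply, add_comm]
  rfl

theorem length_mul_wordProd_lt_of_side {t : W} (ht : cs.IsReflection t) (ω : List B)
    (h : side cs t (cs.wordProd ω) = 1) : cs.length (t * cs.wordProd ω) < ω.length := by
  classical
  induction ω using List.reverseRecOn with
  | nil => simp [side_one] at h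
  | append_singleton ω i ih =>
    rw [cs.wordProd_append, cs.wordProd_singleton] at h ⊢
    rw [List.length_append, List.length_singleton]
    rw [side_mul_simple] at h
    split_ifs at h with hc
    · rw [← hc, ← mul_assoc, ht.mul_self, one_mul]
      exact Nat.lt_succ_of_le (cs.length_wordProd_le ω)
    · have h₁ := ih (by simpa using h)
      have h₂ := cs.length_mul_le (t * cs.wordProd ω) (cs.simple i)
      rw [cs.length_simple, mul_assoc] at h₂
      omega

theorem length_mul_lt_of_side {t : W} (ht : cs.IsReflection t) {w : W}
    (h : side cs t w = 1) : cs.length (t * w) < cs.length w := by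
  obtain ⟨ω, hω, rfl⟩ := cs.exists_isReduced w
  rw [hω.eq]
  exact length_mul_wordProd_lt_of_side cs ht ω h

theorem side_eq_one_iff {t : W} (ht : cs.IsReflection t) (w : W) :
    side cs t w = 1 ↔ cs.length (t * w) < cs.length w := by
  refine ⟨length_mul_lt_of_side cs ht, fun h => ?_⟩
  by_contra hne
  have h0 : side cs t w = 0 := by
    generalize side cs t w = x at hne
    revert x; decide
  have := length_mul_lt_of_side cs ht (w := t * w) (by rw [side_reflection_mul cs ht, h0, zero_add])
  rw [← mul_assoc, ht.mul_self, one_mul] at this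
  omega

theorem sameSide_iff_s2 {t : W} (ht : cs.IsReflection t) (u v : W) :
    SameSide cs t u v ↔ side cs t u = side cs t v := by
  rw [SameSide, ← side_eq_one_iff cs ht, ← side_eq_one_iff cs ht]
  generalize side cs t u = x
  generalize side cs t v = y
  revert x y; decide

/-- Adjacent vertices separated by a wall span an edge of that wall. -/
theorem edgeInWall_of_separatesPts {t u v : W} (ht : cs.IsReflection t) (huv : Adj cs u v)
    (h : SeparatesPts cs t u v) : EdgeInWall cs t u v := by
  classical
  refine ⟨huv, ?_⟩
  obtain ⟨i, rfl⟩ := huv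
  by_contra hne
  exact h ((sameSide_iff_s2 cs ht _ _).2 (by rw [side_mul_simple, if_neg hne, add_zero]))

end ReflectionCocycle

section Paths

variable (cs : CoxeterSystem M W)

theorem d_comm (u v : W) : d cs u v = d cs v u := by
  rw [d, d, ← cs.length_inv, mul_inv_rev, inv_inv]

theorem d_triangle (u v w : W) : d cs u w ≤ d cs u v + d cs v w := by
  have := cs.length_mul_le (u⁻¹ * v) (v⁻¹ * w)
  rwa [mul_assoc, mul_inv_cancel_left] at this

theorem d_mul_left (g u v : W) : d cs (g * u) (g * v) = d cs u v := by
  simp [d, mul_assoc]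

theorem IsPath.d_le {cs : CoxeterSystem M W} {v : ℕ → W} {n : ℕ} (h : IsPath cs v n)
    {i j : ℕ} (hij : i ≤ j) (hj : j ≤ n) : d cs (v i) (v j) ≤ j - i := by
  induction j, hij using Nat.le_induction with
  | base => simp [d]
  | succ j hij ih =>
    have h₁ := ih (by omega)
    have h₂ := d_triangle cs (v i) (v j) (v (j + 1))
    obtain ⟨s, hs⟩ := h j (by omega)
    have h₃ : d cs (v j) (v (j + 1)) = 1 := by
      rw [hs, d, inv_mul_cancel_left, cs.length_simple]
    omega

/-- A path joining two vertices separated by a wall crosses that wall. -/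
theorem IsPath.exists_edgeInWall {cs : CoxeterSystem M W} {v : ℕ → W} {n : ℕ}
    (h : IsPath cs v n) {r : W} (hr : cs.IsReflection r) {i j : ℕ} (hij : i ≤ j) (hj : j ≤ n)
    (hsep : SeparatesPts cs r (v i) (v j)) :
    ∃ k, i ≤ k ∧ k < j ∧ EdgeInWall cs r (v k) (v (k + 1)) := by
  induction j, hij using Nat.le_induction with
  | base => exact absurd Iff.rfl hsep
  | succ j hij ih =>
    by_cases hs : SeparatesPts cs r (v i) (v j)
    · obtain ⟨k, h₁, h₂, h₃⟩ := ih (by omega) hs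
      exact ⟨k, h₁, by omega, h₃⟩
    · refine ⟨j, hij, by omega, edgeInWall_of_separatesPts cs hr (h j (by omega)) fun hs' => ?_⟩
      exact hsep ((not_not.1 hs).trans hs')

/-- A geodesic crosses each wall at most once. -/
theorem IsGeodesic.not_edgeInWall_of_lt {cs : CoxeterSystem M W} {v : ℕ → W} {n : ℕ}
    (h : IsGeodesic cs v n) {r : W} (hr : cs.IsReflection r) {i j : ℕ}
    (hij : i < j) (hj : j < n)
    (hi : EdgeInWall cs r (v i) (v (i + 1))) : ¬ EdgeInWall cs r (v j) (v (j + 1)) := by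
  intro hj'
  have h₁ := h.1.d_le (Nat.zero_le i) (by omega)
  have h₂ := h.1.d_le (show i + 1 ≤ j from hij) hj.le
  have h₃ := h.1.d_le (show j + 1 ≤ n from hj) le_rfl
  have h₄ : r * v (j + 1) = v j := by
    rw [← hj'.2, ← mul_assoc, hr.mul_self, one_mul]
  have h₅ := d_triangle cs (v 0) (v i) (v n)
  have h₆ := d_triangle cs (v i) (v (j + 1)) (v n)
  have h₇ : d cs (v i) (v (j + 1)) = d cs (v (i + 1)) (v j) := by
    rw [← h₄, ← hi.2, d_mul_left]
  have := h.2
  omega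

theorem d_reflection_mul_le {t u p : W} (hu : InWallBar cs t u) :
    d cs p (t * p) ≤ 2 * d cs p u + 1 := by
  obtain ⟨i, hi⟩ := hu
  have h₁ := d_triangle cs p u (t * p)
  have h₂ := d_triangle cs u (t * u) (t * p)
  have h₃ : d cs u (t * u) = 1 := by rw [hi, d, inv_mul_cancel_left, cs.length_simple]
  rw [d_mul_left, d_comm cs u p] at h₂
  omega

end Paths

/-- If a geodesic edge path `α = v 0, …, v n` from `a` to `b` does not cross the wall `Q`
(with reflection `t`), while there are edges of `Q` at `a` and at `b`, then every vertex of
`α` is within `P 1` of `Q̄`; in particular each vertex `v` of `α` satisfies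
`d(v, t v) ≤ 2 P 1 + 1`. -/
theorem reflect_lemma {B : Type*} {W : Type*} [Group W] [Finite B]
    {M : CoxeterMatrix B} (cs : CoxeterSystem M W)
    (P : ℕ → ℕ) (hP : IsParallelWallFn cs P)
    (v : ℕ → W) (n : ℕ) (hgeo : IsGeodesic cs v n)
    (t : W) (ht : cs.IsReflection t)
    (hnocross : ∀ k, k < n → ¬ EdgeInWall cs t (v k) (v (k+1)))
    (ha : InWallBar cs t (v 0)) (hb : InWallBar cs t (v n)) :
    (∀ k, k ≤ n → wallDist cs t (v k) ≤ P 1) ∧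
    (∀ k, k ≤ n → d cs (v k) (t * v k) ≤ 2 * P 1 + 1) := by
  have hlt : ∀ k, k ≤ n → wallDist cs t (v k) ≤ P 1 := by
    intro k hk
    by_contra! hlt
    obtain ⟨T, hT, hrefl, -, hsep⟩ := hP 1 one_pos t (v k) ht hlt.le
    obtain ⟨r, hr⟩ := Finset.card_pos.1 (hT ▸ one_pos)
    obtain ⟨i, -, hik, hi⟩ := hgeo.1.exists_edgeInWall (hrefl r hr) (Nat.zero_le k) hk
      (hsep r hr _ ha)
    obtain ⟨j, hkj, hjn, hj⟩ := hgeo.1.exists_edgeInWall (hrefl r hr) hk le_rfl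
      fun h => hsep r hr _ hb h.symm
    exact hgeo.not_edgeInWall_of_lt (hrefl r hr) (hik.trans_le hkj) hjn hi hj
  refine ⟨hlt, fun k hk => ?_⟩
  obtain ⟨u, hu, hd⟩ := Nat.sInf_mem
    (s := {n : ℕ | ∃ u, InWallBar cs t u ∧ d cs (v k) u = n}) ⟨_, v 0, ha, rfl⟩
  have h₁ : d cs (v k) u ≤ P 1 := hd.trans_le (hlt k hk)
  have h₂ := d_reflection_mul_le cs (p := v k) hu
  omega

end CoxTrack
end
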